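/- arXiv:2109.11438 — 2 statements merged into one kernel-verified Lean document; each statement's English description precedes it below -/
import Mathlib

section
/- For every C > 0 and ε > 0, there exists D₁ = D₁(C, ε) such that the following holds for every D ≥ D₁. Let G₁, …, G_m be graphs, and let L be a list assignment for G := ⋃_{i=1}^m G_i such that: the G_i are nearly disjoint; |{i ∈ [m] : v ∈ V(G_i)}| ≤ C for every v ∈ V(G); Δ(G_i, L|_{V(G_i)}) ≤ D for every i ∈ [m]; and |L(v)| = ⌈Λ⌉ for every v ∈ V(G), where (1 + ε)D ≤ Λ ≤ 10CD. If log⁻¹ D ≥ p ≥ log⁻² D, then there exist X ⊆ V(G), an L|_X-coloring φ of G[X], and a list assignment L' for G − X satisfying L'(v) ⊆ L(v) \ {φ(u) : u ∈ N_G(v) ∩ X} for every v ∈ V(G) \ X, such that (1) |L'(v)| = ⌈λ'(Λ, D, C, p) − Λ^{4/5}⌉ for every v ∈ V(G) \ X, and (2) Δ(G_i − X, L'|_{V(G_i − X)}) ≤ D'(Λ, D, C, p) + D^{4/5} for every i ∈ [m]. -/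
open Finset

/-- `λ'(Λ, D, C, p) = (1 - p/Λ)^{DC} Λ` (real exponents). -/
noncomputable def lamNew (Λ D C p : ℝ) : ℝ := (1 - p / Λ) ^ (D * C) * Λ

/-- `D'(Λ, D, C, p) = ((1 - p)(1 - p/Λ)^{D(C-1)} + p(1 - (1 - p/Λ)^{DC})) D`. -/
noncomputable def degNew (Λ D C p : ℝ) : ℝ :=
  ((1 - p) * (1 - p / Λ) ^ (D * (C - 1)) + p * (1 - (1 - p / Λ) ^ (D * C))) * D

/-- The real-valued indicator of a proposition. -/
noncomputable def propInd (P : Prop) : ℝ := by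
  classical exact if P then 1 else 0

lemma propInd_of {P : Prop} (h : P) : propInd P = 1 := by simp [propInd, h]

lemma propInd_of_not {P : Prop} (h : ¬P) : propInd P = 0 := by simp [propInd, h]

lemma propInd_nonneg (P : Prop) : 0 ≤ propInd P := by
  by_cases h : P
  · simp [propInd_of h]
  · simp [propInd_of_not h]

lemma propInd_le_one (P : Prop) : propInd P ≤ 1 := by
  by_cases h : P
  · simp [propInd_of h]
  · simp [propInd_of_not h]

lemma propInd_and (P Q : Prop) : propInd (P ∧ Q) = propInd P * propInd Q := by
  by_cases h : P <;> by_cases h' : Q <;> simp [propInd, h, h']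

lemma propInd_not (P : Prop) : propInd (¬P) = 1 - propInd P := by
  by_cases h : P <;> simp [propInd, h]

lemma propInd_mono {P Q : Prop} (h : P → Q) : propInd P ≤ propInd Q := by
  by_cases hP : P
  · rw [propInd_of hP, propInd_of (h hP)]
  · rw [propInd_of_not hP]; exact propInd_nonneg Q

lemma propInd_or_le (P Q : Prop) : propInd (P ∨ Q) ≤ propInd P + propInd Q := by
  by_cases h : P <;> by_cases h' : Q <;> simp [propInd, h, h']

lemma propInd_exists_le {α : Type*} (s : Finset α) (P : α → Prop) :
    propInd (∃ a ∈ s, P a) ≤ ∑ a ∈ s, propInd (P a) := by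
  by_cases h : ∃ a ∈ s, P a
  · obtain ⟨a, ha, hP⟩ := h
    calc propInd (∃ a ∈ s, P a) ≤ 1 := propInd_le_one _
      _ = propInd (P a) := (propInd_of hP).symm
      _ ≤ _ := single_le_sum (f := fun a => propInd (P a)) (fun b _ => propInd_nonneg _) ha
  · rw [propInd_of_not h]
    exact sum_nonneg fun b _ => propInd_nonneg _

lemma propInd_forall {α : Type*} (s : Finset α) (P : α → Prop) :
    propInd (∀ a ∈ s, P a) = ∏ a ∈ s, propInd (P a) := by
  by_cases h : ∀ a ∈ s, P a
  · rw [propInd_of h, prod_eq_one fun a ha => propInd_of (h a ha)]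
  · rw [propInd_of_not h]
    push Not at h
    obtain ⟨a, ha, hP⟩ := h
    exact (prod_eq_zero ha (propInd_of_not hP)).symm

lemma sum_propInd {α : Type*} (s : Finset α) (P : α → Prop) [DecidablePred P] :
    ∑ a ∈ s, propInd (P a) = ((s.filter P).card : ℝ) := by
  rw [card_filter]
  push_cast
  refine sum_congr rfl fun a _ => ?_
  by_cases h : P a <;> simp [propInd, h]

lemma dependsOn_finset_prod {I T α : Type*} (s : Finset α) (g : α → (I → T) → ℝ) (A : α → Set I)
    (hg : ∀ a ∈ s, DependsOn (g a) (A a)) :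
    DependsOn (fun x => ∏ a ∈ s, g a x) {i | ∃ a ∈ s, i ∈ A a} := fun _ _ h =>
  prod_congr rfl fun a ha => hg a ha fun i hi => h i ⟨a, ha, hi⟩

/-- A family of finitely supported probability distributions on `T`, one for each coordinate. -/
structure ProductWeights (I T : Type*) where
  supp : I → Finset T
  w : I → T → ℝ
  nonneg : ∀ i, ∀ t ∈ supp i, 0 ≤ w i t
  sum_one : ∀ i, ∑ t ∈ supp i, w i t = 1

namespace ProductWeights

variable {I T : Type*} [DecidableEq I] (M : ProductWeights I T)

/-- Averaging over one coordinate. -/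
noncomputable def avg (i : I) (f : (I → T) → ℝ) : (I → T) → ℝ :=
  fun x => ∑ t ∈ M.supp i, M.w i t * f (Function.update x i t)

/-- Averaging over a list of coordinates. -/
noncomputable def expect (l : List I) (f : (I → T) → ℝ) : (I → T) → ℝ :=
  l.foldr M.avg f

@[simp] lemma expect_nil (f : (I → T) → ℝ) : M.expect [] f = f := rfl

@[simp] lemma expect_cons (i : I) (l : List I) (f : (I → T) → ℝ) :
    M.expect (i :: l) f = M.avg i (M.expect l f) := rfl

lemma avg_comm (i j : I) (f : (I → T) → ℝ) : M.avg i (M.avg j f) = M.avg j (M.avg i f) := by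
  rcases eq_or_ne i j with rfl | hij
  · rfl
  funext x
  simp only [avg, mul_sum]
  rw [sum_comm]
  refine sum_congr rfl fun t _ => sum_congr rfl fun s _ => ?_
  rw [Function.update_comm hij]
  ring

lemma expect_perm {l₁ l₂ : List I} (h : l₁.Perm l₂) (f : (I → T) → ℝ) :
    M.expect l₁ f = M.expect l₂ f :=
  haveI : LeftCommutative M.avg := ⟨M.avg_comm⟩
  h.foldr_eq f

lemma avg_add (i : I) (f g : (I → T) → ℝ) :
    M.avg i (fun x => f x + g x) = fun x => M.avg i f x + M.avg i g x := by
  funext x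
  simp [avg, mul_add, sum_add_distrib]

lemma avg_const_mul (i : I) (a : ℝ) (f : (I → T) → ℝ) :
    M.avg i (fun x => a * f x) = fun x => a * M.avg i f x := by
  funext x
  simp only [avg, mul_sum]
  exact sum_congr rfl fun t _ => by ring

lemma avg_const (i : I) (a : ℝ) : M.avg i (fun _ => a) = fun _ => a := by
  funext x
  simp [avg, ← sum_mul, M.sum_one]

lemma expect_add (l : List I) (f g : (I → T) → ℝ) :
    M.expect l (fun x => f x + g x) = fun x => M.expect l f x + M.expect l g x := by
  induction l with
  | nil => rfl
  | cons i l ih => simp only [expect_cons, ih, avg_add]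

lemma expect_const_mul (l : List I) (a : ℝ) (f : (I → T) → ℝ) :
    M.expect l (fun x => a * f x) = fun x => a * M.expect l f x := by
  induction l with
  | nil => rfl
  | cons i l ih => simp only [expect_cons, ih, avg_const_mul]

lemma expect_const (l : List I) (a : ℝ) : M.expect l (fun _ => a) = fun _ => a := by
  induction l with
  | nil => rfl
  | cons i l ih => simp only [expect_cons, ih, avg_const]

lemma expect_sub (l : List I) (f g : (I → T) → ℝ) :
    M.expect l (fun x => f x - g x) = fun x => M.expect l f x - M.expect l g x := by
  have h := M.expect_add l f (fun x => -1 * g x)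
  rw [expect_const_mul] at h
  simpa [sub_eq_add_neg] using h

lemma expect_sum {α : Type*} (l : List I) (s : Finset α) (f : α → (I → T) → ℝ) :
    M.expect l (fun x => ∑ a ∈ s, f a x) = fun x => ∑ a ∈ s, M.expect l (f a) x := by
  classical
  induction s using Finset.induction_on with
  | empty => simpa using M.expect_const l 0
  | insert a s ha ih => simp only [sum_insert ha, expect_add, ih]

lemma expect_le_on_fiber (l : List I) {f g : (I → T) → ℝ} (x₀ : I → T)
    (h : ∀ x, (∀ j, j ∉ l → x j = x₀ j) → f x ≤ g x) : M.expect l f x₀ ≤ M.expect l g x₀ := by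
  induction l generalizing x₀ with
  | nil => exact h x₀ fun _ _ => rfl
  | cons i l ih =>
    simp only [expect_cons, avg]
    refine sum_le_sum fun t ht => mul_le_mul_of_nonneg_left (ih _ fun x hx => h x fun j hj => ?_)
      (M.nonneg i t ht)
    rw [List.mem_cons, not_or] at hj
    rw [hx j hj.2, Function.update_of_ne hj.1]

lemma expect_mono (l : List I) {f g : (I → T) → ℝ} (h : ∀ x, f x ≤ g x) (x₀ : I → T) :
    M.expect l f x₀ ≤ M.expect l g x₀ :=
  M.expect_le_on_fiber l x₀ fun x _ => h x

lemma expect_nonneg (l : List I) {f : (I → T) → ℝ} (h : ∀ x, 0 ≤ f x) (x₀ : I → T) :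
    0 ≤ M.expect l f x₀ := by
  simpa [M.expect_const l 0] using M.expect_mono l h x₀

lemma expect_update {i : I} {l : List I} (hi : i ∉ l) (f : (I → T) → ℝ) (t : T) (x : I → T) :
    M.expect l f (Function.update x i t) = M.expect l (fun y => f (Function.update y i t)) x := by
  induction l generalizing x with
  | nil => rfl
  | cons j l ih =>
    rw [List.mem_cons, not_or] at hi
    simp only [expect_cons, avg]
    refine sum_congr rfl fun s _ => ?_
    rw [← ih hi.2, Function.update_comm hi.1]

lemma avg_of_dependsOn {f : (I → T) → ℝ} {s : Set I} (hf : DependsOn f s) {i : I} (hi : i ∉ s) :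
    M.avg i f = f := by
  funext x
  have : ∀ t, f (Function.update x i t) = f x := fun t => hf fun j hj =>
    Function.update_of_ne (ne_of_mem_of_not_mem hj hi) _ _
  simp [avg, this, ← sum_mul, M.sum_one]

lemma expect_of_dependsOn {f : (I → T) → ℝ} {s : Set I} (hf : DependsOn f s) {l : List I}
    (hl : ∀ i ∈ l, i ∉ s) : M.expect l f = f := by
  induction l with
  | nil => rfl
  | cons i l ih =>
    rw [expect_cons, ih fun j hj => hl j (List.mem_cons_of_mem _ hj),
      M.avg_of_dependsOn hf (hl i List.mem_cons_self)]

lemma dependsOn_avg {f : (I → T) → ℝ} {s : Set I} (hf : DependsOn f s) (i : I) :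
    DependsOn (M.avg i f) (s \ {i}) := by
  intro x y hxy
  refine sum_congr rfl fun t _ => ?_
  congr 1
  refine hf fun j hj => ?_
  by_cases hji : j = i
  · subst hji; simp
  · rw [Function.update_of_ne hji, Function.update_of_ne hji, hxy j ⟨hj, hji⟩]

lemma dependsOn_expect {f : (I → T) → ℝ} {s : Set I} (hf : DependsOn f s) (l : List I) :
    DependsOn (M.expect l f) s := by
  induction l with
  | nil => exact hf
  | cons i l ih => exact fun x y h => M.dependsOn_avg ih i fun j hj => h j hj.1

lemma avg_mul {f g : (I → T) → ℝ} {A B : Set I} (hf : DependsOn f A) (hg : DependsOn g B)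
    (h : Disjoint A B) (i : I) :
    M.avg i (fun x => f x * g x) = fun x => M.avg i f x * M.avg i g x := by
  have key : ∀ {f g : (I → T) → ℝ} {A : Set I}, DependsOn f A → i ∉ A →
      M.avg i (fun x => f x * g x) = fun x => M.avg i f x * M.avg i g x := by
    intro f g A hf hi
    rw [M.avg_of_dependsOn hf hi]
    funext x
    simp only [avg, mul_sum]
    refine sum_congr rfl fun t _ => ?_
    have : f (Function.update x i t) = f x := hf fun j hj =>
      Function.update_of_ne (ne_of_mem_of_not_mem hj hi) _ _
    rw [this]; ring
  by_cases hi : i ∈ A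
  · have := key (f := g) (g := f) hg (Set.disjoint_left.1 h hi)
    simpa [mul_comm] using this
  · exact key hf hi

lemma expect_mul {f g : (I → T) → ℝ} {A B : Set I} (hf : DependsOn f A) (hg : DependsOn g B)
    (h : Disjoint A B) (l : List I) :
    M.expect l (fun x => f x * g x) = fun x => M.expect l f x * M.expect l g x := by
  induction l with
  | nil => rfl
  | cons i l ih =>
    simp only [expect_cons, ih]
    exact M.avg_mul (M.dependsOn_expect hf l) (M.dependsOn_expect hg l) h i

lemma expect_prod {α : Type*} (l : List I) (s : Finset α) (g : α → (I → T) → ℝ)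
    (A : α → Set I) (hg : ∀ a ∈ s, DependsOn (g a) (A a))
    (hA : ∀ a ∈ s, ∀ b ∈ s, a ≠ b → Disjoint (A a) (A b)) :
    M.expect l (fun x => ∏ a ∈ s, g a x) = fun x => ∏ a ∈ s, M.expect l (g a) x := by
  classical
  induction s using Finset.induction_on with
  | empty => simpa using M.expect_const l 1
  | insert a s ha ih =>
    simp only [prod_insert ha]
    rw [M.expect_mul (hg a (mem_insert_self _ _))
      (dependsOn_finset_prod s g A fun b hb => hg b (mem_insert_of_mem hb)),
      ih (fun b hb => hg b (mem_insert_of_mem hb))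
        (fun b hb c hc => hA b (mem_insert_of_mem hb) c (mem_insert_of_mem hc))]
    rw [Set.disjoint_left]
    rintro i hi ⟨b, hb, hib⟩
    exact Set.disjoint_left.1 (hA a (mem_insert_self _ _) b (mem_insert_of_mem hb)
      (fun h => ha (h ▸ hb))) hi hib

lemma expect_eq_avg {f : (I → T) → ℝ} {i : I} (hf : DependsOn f {i}) {l : List I} (hi : i ∈ l) :
    M.expect l f = M.avg i f := by
  induction l with
  | nil => simp at hi
  | cons j l ih =>
    rw [expect_cons]
    by_cases h : i ∈ l
    · rw [ih h]
      exact M.avg_of_dependsOn (M.dependsOn_avg hf i) (by simp)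
    · obtain rfl : i = j := by simpa [h] using hi
      rw [M.expect_of_dependsOn hf]
      rintro k hk rfl
      exact h hk

lemma expect_propInd_pos {l : List I} {P : (I → T) → Prop} {x₀ : I → T}
    (h : 0 < M.expect l (fun x => propInd (P x)) x₀) : ∃ x, P x := by
  by_contra! hP
  rw [funext fun x => propInd_of_not (hP x), M.expect_const] at h
  exact lt_irrefl _ h

lemma exp_le_one_add_add_sq {z : ℝ} (hz : |z| ≤ 1) : Real.exp z ≤ 1 + z + z ^ 2 := by
  have := (abs_le.1 (Real.abs_exp_sub_one_sub_id_le hz)).2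
  linarith

/-- A Bernstein-type bound on the exponential moment over a single coordinate. -/
lemma avg_exp_le (i : I) (t₀ : T) (g : (I → T) → ℝ) (r : T → ℝ) (a b : ℝ)
    (hrb : ∀ t, r t ≤ b) (hab : |a| * b ≤ 1) (x : I → T)
    (hg : ∀ t ∈ M.supp i, |g (Function.update x i t) - g (Function.update x i t₀)| ≤ r t) :
    M.avg i (fun y => Real.exp (a * g y)) x ≤
      Real.exp (a * M.avg i g x + a ^ 2 * ∑ t ∈ M.supp i, M.w i t * r t ^ 2) := by
  set g₀ := g (Function.update x i t₀) with hg₀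
  have h1 : ∀ t ∈ M.supp i, Real.exp (a * g (Function.update x i t)) ≤
      Real.exp (a * g₀) * (1 + a * (g (Function.update x i t) - g₀) + a ^ 2 * r t ^ 2) := by
    intro t ht
    have hr : 0 ≤ r t := (abs_nonneg _).trans (hg t ht)
    have hz : |a * (g (Function.update x i t) - g₀)| ≤ 1 := by
      rw [abs_mul]
      exact (mul_le_mul_of_nonneg_left ((hg t ht).trans (hrb t)) (abs_nonneg a)).trans hab
    have h2 := exp_le_one_add_add_sq hz
    have h3 : (a * (g (Function.update x i t) - g₀)) ^ 2 ≤ a ^ 2 * r t ^ 2 := by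
      rw [mul_pow]
      refine mul_le_mul_of_nonneg_left ?_ (sq_nonneg a)
      rw [← sq_abs]
      exact pow_le_pow_left₀ (abs_nonneg _) (hg t ht) 2
    calc Real.exp (a * g (Function.update x i t))
        = Real.exp (a * g₀) * Real.exp (a * (g (Function.update x i t) - g₀)) := by
          rw [← Real.exp_add]; congr 1; ring
      _ ≤ _ := mul_le_mul_of_nonneg_left (by linarith) (Real.exp_pos _).le
  have h4 : M.avg i (fun y => Real.exp (a * g y)) x ≤ Real.exp (a * g₀) *
      (1 + a * (M.avg i g x - g₀) + a ^ 2 * ∑ t ∈ M.supp i, M.w i t * r t ^ 2) := by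
    calc M.avg i (fun y => Real.exp (a * g y)) x
        ≤ ∑ t ∈ M.supp i, M.w i t * (Real.exp (a * g₀) *
          (1 + a * (g (Function.update x i t) - g₀) + a ^ 2 * r t ^ 2)) :=
          sum_le_sum fun t ht => mul_le_mul_of_nonneg_left (h1 t ht) (M.nonneg i t ht)
      _ = Real.exp (a * g₀) * ((1 - a * g₀) * ∑ t ∈ M.supp i, M.w i t + a * M.avg i g x +
          a ^ 2 * ∑ t ∈ M.supp i, M.w i t * r t ^ 2) := by
          simp only [avg, mul_sum, ← sum_add_distrib]
          exact sum_congr rfl fun t _ => by ring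
      _ = _ := by rw [M.sum_one]; ring
  refine h4.trans ?_
  calc _ ≤ Real.exp (a * g₀) * Real.exp (a * (M.avg i g x - g₀) +
        a ^ 2 * ∑ t ∈ M.supp i, M.w i t * r t ^ 2) := by
        refine mul_le_mul_of_nonneg_left ?_ (Real.exp_pos _).le
        have := Real.add_one_le_exp (a * (M.avg i g x - g₀) +
          a ^ 2 * ∑ t ∈ M.supp i, M.w i t * r t ^ 2)
        linarith
    _ = _ := by rw [← Real.exp_add]; congr 1; ring

/-- A Bernstein-type bound on exponential moments: coordinates in `l₁` are exposed on top of a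
bound that is already available for the coordinates in `l₂`. -/
lemma expect_exp_le_append (t₀ : T) (f : (I → T) → ℝ) (r : I → T → ℝ) (a b V : ℝ)
    (hrb : ∀ i t, r i t ≤ b) (hab : |a| * b ≤ 1) (l₁ l₂ : List I) (hl : (l₁ ++ l₂).Nodup)
    (x₀ : I → T)
    (hf : ∀ i ∈ l₁, ∀ x, (∀ j, j ∉ l₁ ++ l₂ → x j = x₀ j) → ∀ t ∈ M.supp i,
      |f (Function.update x i t) - f (Function.update x i t₀)| ≤ r i t)
    (hbase : ∀ x, (∀ j, j ∉ l₁ → x j = x₀ j) → M.expect l₂ (fun y => Real.exp (a * f y)) x ≤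
      Real.exp (a * M.expect l₂ f x + a ^ 2 * V)) :
    M.expect (l₁ ++ l₂) (fun y => Real.exp (a * f y)) x₀ ≤
      Real.exp (a * M.expect (l₁ ++ l₂) f x₀ +
        a ^ 2 * (V + (l₁.map fun i => ∑ t ∈ M.supp i, M.w i t * r i t ^ 2).sum)) := by
  induction l₁ generalizing x₀ with
  | nil => simpa using hbase x₀ fun _ _ => rfl
  | cons i l ih =>
    rw [List.cons_append, List.nodup_cons] at hl
    simp only [List.cons_append, expect_cons, List.map_cons, List.sum_cons]
    set V' := V + (l.map fun i => ∑ t ∈ M.supp i, M.w i t * r i t ^ 2).sum with hV'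
    have step : ∀ t, M.expect (l ++ l₂) (fun y => Real.exp (a * f y)) (Function.update x₀ i t) ≤
        Real.exp (a * M.expect (l ++ l₂) f (Function.update x₀ i t) + a ^ 2 * V') := by
      intro t
      refine ih hl.2 _ (fun j hj x hx => hf j (List.mem_cons_of_mem _ hj) x fun k hk => ?_)
        (fun x hx => hbase x fun k hk => ?_)
      · rw [List.cons_append, List.mem_cons, not_or] at hk
        rw [hx k hk.2, Function.update_of_ne hk.1]
      · rw [List.mem_cons, not_or] at hk
        rw [hx k hk.2, Function.update_of_ne hk.1]
    have hdiff : ∀ t ∈ M.supp i, |M.expect (l ++ l₂) f (Function.update x₀ i t) -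
        M.expect (l ++ l₂) f (Function.update x₀ i t₀)| ≤ r i t := by
      intro t ht
      rw [M.expect_update hl.1, M.expect_update hl.1]
      have h1 := congrFun (M.expect_sub (l ++ l₂) (fun y => f (Function.update y i t))
        (fun y => f (Function.update y i t₀))) x₀
      rw [← h1, abs_le]
      have hb : ∀ x, (∀ j, j ∉ l ++ l₂ → x j = x₀ j) →
          |f (Function.update x i t) - f (Function.update x i t₀)| ≤ r i t := fun x hx =>
        hf i List.mem_cons_self x (fun j hj => hx j fun h => hj (List.mem_cons_of_mem _ h)) t ht
      constructor
      · have := M.expect_le_on_fiber (l ++ l₂) (f := fun _ => -r i t) x₀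
          fun x hx => (abs_le.1 (hb x hx)).1
        rwa [M.expect_const] at this
      · have := M.expect_le_on_fiber (l ++ l₂) (g := fun _ => r i t) x₀
          fun x hx => (abs_le.1 (hb x hx)).2
        rwa [M.expect_const] at this
    calc M.avg i (M.expect (l ++ l₂) fun y => Real.exp (a * f y)) x₀
        ≤ M.avg i (fun y => Real.exp (a ^ 2 * V') * Real.exp (a * M.expect (l ++ l₂) f y)) x₀ := by
          refine sum_le_sum fun t ht => mul_le_mul_of_nonneg_left ?_ (M.nonneg i t ht)
          beta_reduce
          rw [← Real.exp_add, add_comm (a ^ 2 * V')]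
          exact step t
      _ = Real.exp (a ^ 2 * V') * M.avg i (fun y => Real.exp (a * M.expect (l ++ l₂) f y)) x₀ := by
          rw [M.avg_const_mul]
      _ ≤ Real.exp (a ^ 2 * V') * Real.exp (a * M.avg i (M.expect (l ++ l₂) f) x₀ +
            a ^ 2 * ∑ t ∈ M.supp i, M.w i t * r i t ^ 2) :=
          mul_le_mul_of_nonneg_left
            (M.avg_exp_le i t₀ _ (r i) a b (hrb i) hab x₀ hdiff) (Real.exp_pos _).le
      _ = _ := by rw [← Real.exp_add]; congr 1; rw [hV']; ring

lemma expect_exp_le (t₀ : T) (f : (I → T) → ℝ) (r : I → T → ℝ) (a b : ℝ)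
    (hrb : ∀ i t, r i t ≤ b) (hab : |a| * b ≤ 1) (l : List I) (hl : l.Nodup) (x₀ : I → T)
    (hf : ∀ i ∈ l, ∀ x, (∀ j, j ∉ l → x j = x₀ j) → ∀ t ∈ M.supp i,
      |f (Function.update x i t) - f (Function.update x i t₀)| ≤ r i t) :
    M.expect l (fun y => Real.exp (a * f y)) x₀ ≤
      Real.exp (a * M.expect l f x₀ +
        a ^ 2 * (l.map fun i => ∑ t ∈ M.supp i, M.w i t * r i t ^ 2).sum) := by
  have := M.expect_exp_le_append t₀ f r a b 0 hrb hab l [] (by simpa using hl) x₀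
    (by simpa using hf) (by simp)
  simpa using this

/-- Upper tail bound from an exponential moment bound. -/
lemma expect_propInd_le_of_exp (l : List I) (f : (I → T) → ℝ) (a m t V : ℝ) (x₀ : I → T)
    (ha : 0 ≤ a) (hm : M.expect l f x₀ ≤ m)
    (h : M.expect l (fun y => Real.exp (a * f y)) x₀ ≤ Real.exp (a * M.expect l f x₀ + a ^ 2 * V)) :
    M.expect l (fun y => propInd (m + t ≤ f y)) x₀ ≤ Real.exp (a ^ 2 * V - a * t) := by
  have h1 : ∀ y, propInd (m + t ≤ f y) ≤ Real.exp (-(a * (m + t))) * Real.exp (a * f y) := by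
    intro y
    rw [← Real.exp_add]
    by_cases hy : m + t ≤ f y
    · rw [propInd_of hy]
      exact Real.one_le_exp (by nlinarith)
    · rw [propInd_of_not hy]
      exact (Real.exp_pos _).le
  refine (M.expect_mono l h1 x₀).trans ?_
  rw [M.expect_const_mul]
  refine (mul_le_mul_of_nonneg_left h (Real.exp_pos _).le).trans ?_
  rw [← Real.exp_add, Real.exp_le_exp]
  nlinarith

/-- The symmetric Lovász Local Lemma for events in a finite product space. -/
theorem exists_forall_not_of_local {ι : Type*} [Fintype ι] [DecidableEq ι] (l : List I) (x₀ : I → T)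
    (P : ι → (I → T) → Prop) (vbl : ι → Set I)
    (hP : ∀ a x y, (∀ i ∈ vbl a, x i = y i) → (P a x ↔ P a y))
    (nbr : ι → Finset ι) (hn : ∀ a b, b ∉ nbr a → Disjoint (vbl a) (vbl b))
    (d q : ℝ) (hd : 1 ≤ d) (hcard : ∀ a, ((nbr a).card : ℝ) ≤ d) (hq : 0 ≤ q)
    (hPq : ∀ a, M.expect l (fun x => propInd (P a x)) x₀ ≤ q) (hdq : 4 * q * d ≤ 1) :
    ∃ x, ∀ a, ¬P a x := by
  have hq4 : 4 * q ≤ 1 := by nlinarith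
  let E : Finset ι → ((I → T) → Prop) → ℝ := fun S R =>
    M.expect l (fun x => propInd (R x) * propInd (∀ b ∈ S, ¬P b x)) x₀
  have hE0 : ∀ S R, 0 ≤ E S R := fun S R => M.expect_nonneg l
    (fun x => mul_nonneg (propInd_nonneg _) (propInd_nonneg _)) x₀
  have key : ∀ n : ℕ, ∀ S : Finset ι, S.card = n → ∀ a,
      E S (P a) ≤ 2 * q * E S (fun _ => True) := by
    intro n
    induction n using Nat.strong_induction_on with
    | _ n ih =>
    intro S hS a
    set S₂ := S.filter (· ∉ nbr a) with hS₂
    set S₁ := S.filter (· ∈ nbr a) with hS₁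
    have h1 : E S (P a) ≤ E S₂ (P a) := M.expect_mono l (fun x => mul_le_mul_of_nonneg_left
      (propInd_mono fun h b hb => h b (mem_filter.1 hb).1) (propInd_nonneg _)) x₀
    have h2 : E S₂ (P a) ≤ q * E S₂ (fun _ => True) := by
      have hdep1 : DependsOn (fun x => propInd (P a x)) (vbl a) := fun x y h => by
        simp only [hP a x y h]
      have hdep2 : DependsOn (fun x => propInd (∀ b ∈ S₂, ¬P b x)) {i | ∃ b ∈ S₂, i ∈ vbl b} := by
        intro x y h
        have : (∀ b ∈ S₂, ¬P b x) ↔ (∀ b ∈ S₂, ¬P b y) :=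
          forall₂_congr fun b hb => not_congr (hP b x y fun i hi => h i ⟨b, hb, hi⟩)
        simp only [this]
      have hdisj : Disjoint (vbl a) {i | ∃ b ∈ S₂, i ∈ vbl b} := by
        rw [Set.disjoint_left]
        rintro i hi ⟨b, hb, hib⟩
        exact Set.disjoint_left.1 (hn a b (mem_filter.1 hb).2) hi hib
      have h3 := congrFun (M.expect_mul hdep1 hdep2 hdisj l) x₀
      simp only [E, h3, propInd_of trivial, one_mul]
      exact mul_le_mul_of_nonneg_right (hPq a)
        (M.expect_nonneg l (fun x => propInd_nonneg _) x₀)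
    have h3 : E S₂ (fun _ => True) ≤ 2 * E S (fun _ => True) := by
      rcases S₁.eq_empty_or_nonempty with h0 | hne
      · have : S₂ = S := by
          rw [hS₂, filter_eq_self]
          intro b hb hb'
          have : b ∈ S₁ := mem_filter.2 ⟨hb, hb'⟩
          simp [h0] at this
        rw [this]
        linarith [hE0 S (fun _ => True)]
      · have hlt : S₂.card < n := by
          obtain ⟨b, hb⟩ := hne
          rw [← hS]
          refine card_lt_card (filter_ssubset.2 ⟨b, (mem_filter.1 hb).1, ?_⟩)
          simpa using (mem_filter.1 hb).2
        have h4 : E S₂ (fun _ => True) ≤ E S (fun _ => True) + ∑ b ∈ S₁, E S₂ (P b) := by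
          have hpt : ∀ x, propInd True * propInd (∀ b ∈ S₂, ¬P b x) ≤
              propInd True * propInd (∀ b ∈ S, ¬P b x) +
              ∑ b ∈ S₁, propInd (P b x) * propInd (∀ b ∈ S₂, ¬P b x) := by
            intro x
            rw [← sum_mul, propInd_of trivial, one_mul, one_mul]
            by_cases hx : ∀ b ∈ S₂, ¬P b x
            · rw [propInd_of hx, mul_one]
              refine le_trans ?_ (add_le_add_right (propInd_exists_le S₁ fun b => P b x) _)
              refine le_trans ?_ (propInd_or_le _ _)
              rw [propInd_of]
              by_contra! hcon
              obtain ⟨⟨b, hb, hbP⟩, hS₁'⟩ := hcon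
              by_cases hbn : b ∈ nbr a
              · exact hS₁' b (mem_filter.2 ⟨hb, hbn⟩) hbP
              · exact hx b (mem_filter.2 ⟨hb, hbn⟩) hbP
            · rw [propInd_of_not hx, mul_zero, add_zero]
              exact propInd_nonneg _
          refine (M.expect_mono l hpt x₀).trans_eq ?_
          rw [M.expect_add, M.expect_sum]
        have h5 : ∑ b ∈ S₁, E S₂ (P b) ≤ ∑ b ∈ S₁, 2 * q * E S₂ (fun _ => True) :=
          sum_le_sum fun b _ => ih _ hlt S₂ rfl b
        have h6 : (S₁.card : ℝ) ≤ d := le_trans (by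
          exact_mod_cast card_le_card fun b hb => (mem_filter.1 hb).2) (hcard a)
        rw [sum_const, nsmul_eq_mul] at h5
        have h7 : (S₁.card : ℝ) * (2 * q * E S₂ (fun _ => True)) ≤ 1 / 2 * E S₂ (fun _ => True) := by
          have : (S₁.card : ℝ) * (2 * q) ≤ 1 / 2 := by nlinarith
          nlinarith [hE0 S₂ (fun _ => True)]
        linarith
    nlinarith [hE0 S₂ (fun _ => True), hE0 S (fun _ => True)]
  have pos : ∀ S : Finset ι, 0 < E S (fun _ => True) := by
    intro S
    induction S using Finset.induction_on with
    | empty => simp [E, propInd_of, M.expect_const]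
    | insert a S ha ih =>
      have h1 : E S (fun _ => True) ≤ E (insert a S) (fun _ => True) + E S (P a) := by
        have hpt : ∀ x, propInd True * propInd (∀ b ∈ S, ¬P b x) ≤
            propInd True * propInd (∀ b ∈ insert a S, ¬P b x) +
            propInd (P a x) * propInd (∀ b ∈ S, ¬P b x) := by
          intro x
          rw [propInd_of trivial, one_mul, one_mul, ← propInd_and]
          refine le_trans ?_ (propInd_or_le _ _)
          refine propInd_mono fun h => ?_
          by_cases hx : P a x
          · exact Or.inr ⟨hx, h⟩
          · left
            intro b hb
            rcases mem_insert.1 hb with rfl | hb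
            · exact hx
            · exact h b hb
        refine (M.expect_mono l hpt x₀).trans_eq ?_
        rw [M.expect_add]
      have h2 := key _ S rfl a
      nlinarith
  have h := pos univ
  simp only [E, propInd_of trivial, one_mul] at h
  obtain ⟨x, hx⟩ := M.expect_propInd_pos h
  exact ⟨x, fun a => hx a (mem_univ a)⟩

end ProductWeights

lemma propInd_sq (P : Prop) : propInd P ^ 2 = propInd P := by
  by_cases h : P <;> simp [propInd, h]

lemma abs_sum_propInd_sub_le {α : Type*} (s : Finset α) (P Q : α → Prop) :
    |∑ a ∈ s, propInd (P a) - ∑ a ∈ s, propInd (Q a)| ≤ ∑ a ∈ s, propInd (¬(P a ↔ Q a)) := by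
  rw [← sum_sub_distrib]
  refine (abs_sum_le_sum_abs _ _).trans (sum_le_sum fun a _ => ?_)
  by_cases h : P a <;> by_cases h' : Q a <;> simp [propInd, h, h']

lemma sum_propInd_le_of_unique {α : Type*} (s : Finset α) (P : α → Prop)
    (h : ∀ a ∈ s, ∀ b ∈ s, P a → P b → a = b) :
    ∑ a ∈ s, propInd (P a) ≤ propInd (∃ a ∈ s, P a) := by
  by_cases hP : ∃ a ∈ s, P a
  · obtain ⟨a, ha, hPa⟩ := hP
    rw [propInd_of ⟨a, ha, hPa⟩, sum_eq_single_of_mem a ha, propInd_of hPa]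
    exact fun b hb hba => propInd_of_not fun hPb => hba (h b hb a ha hPb hPa)
  · rw [propInd_of_not hP]
    push Not at hP
    exact (sum_eq_zero fun a ha => propInd_of_not (hP a ha)).le

lemma sum_propInd_mem_and_le {α : Type*} [DecidableEq α] (s t : Finset α) (P : α → Prop) :
    ∑ a ∈ s, propInd (a ∈ t ∧ P a) ≤ ∑ a ∈ t, propInd (P a) := by
  calc ∑ a ∈ s, propInd (a ∈ t ∧ P a) = ∑ a ∈ s with a ∈ t, propInd (P a) := by
        rw [sum_filter]
        refine sum_congr rfl fun a _ => ?_
        rw [propInd_and]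
        by_cases h : a ∈ t <;> simp [propInd_of, propInd_of_not, h]
    _ ≤ _ := sum_le_sum_of_subset_of_nonneg (fun a ha => (mem_filter.1 ha).2)
        fun a _ _ => propInd_nonneg _

lemma sum_propInd_mem_le {α : Type*} [DecidableEq α] (s t : Finset α) :
    ∑ a ∈ s, propInd (a ∈ t) ≤ (t.card : ℝ) := by
  have := sum_propInd_mem_and_le s t fun _ => True
  simpa [propInd_of] using this

/-- The data of one nibble step: a graph, lists of size `ℓ`, the activation probability `p`, and
the probabilities `β v c` of the equalizing coin flips. -/
structure Nibble (V : Type*) where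
  H : SimpleGraph V
  L : V → Finset ℕ
  ℓ : ℕ
  ℓ_pos : 0 < ℓ
  card_L : ∀ v, (L v).card = ℓ
  p : ℝ
  p_nonneg : 0 ≤ p
  p_le_one : p ≤ 1
  β : V → ℕ → ℝ
  β_nonneg : ∀ v c, 0 ≤ β v c
  β_le_one : ∀ v c, β v c ≤ 1

namespace Nibble

variable {V : Type*} (N : Nibble V)

lemma ℓ_pos' : (0 : ℝ) < N.ℓ := by exact_mod_cast N.ℓ_pos

lemma div_nonneg' : 0 ≤ N.p / N.ℓ := div_nonneg N.p_nonneg N.ℓ_pos'.le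

/-- The coordinate `(v, none)` holds the random color of `v` (or `none` if `v` is not activated);
the coordinate `(v, some c)` holds the coin flip of `v` for the color `c`, where `none` means that
the color is not discarded. -/
noncomputable def weights : ProductWeights (V × Option ℕ) (Option ℕ) where
  supp i := match i with
    | (v, none) => insertNone (N.L v)
    | (_, some _) => {none, some 0}
  w i t := match i, t with
    | (_, none), none => 1 - N.p
    | (_, none), some _ => N.p / N.ℓ
    | (v, some c), none => N.β v c
    | (v, some c), some _ => 1 - N.β v c
  nonneg := by
    rintro ⟨v, _ | c⟩ (_ | t) -
    · exact sub_nonneg.2 N.p_le_one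
    · exact N.div_nonneg'
    · exact N.β_nonneg v c
    · exact sub_nonneg.2 (N.β_le_one v c)
  sum_one := by
    rintro ⟨v, _ | c⟩
    · simp only [sum_insertNone, sum_const, N.card_L, nsmul_eq_mul]
      rw [mul_div_cancel₀ _ N.ℓ_pos'.ne']
      ring
    · rw [sum_pair (by simp)]
      ring

variable [Fintype V]

/-- The relevant coordinates. -/
noncomputable def coordSet : Finset (V × Option ℕ) :=
  (univ : Finset V) ×ˢ insertNone (univ.biUnion N.L)

noncomputable def coords : List (V × Option ℕ) := N.coordSet.toList

lemma vertex_mem_coords (v : V) : (v, none) ∈ N.coords := by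
  simp [coords, coordSet]

lemma coin_mem_coords {v : V} {c : ℕ} (hc : c ∈ N.L v) : (v, some c) ∈ N.coords := by
  simp only [coords, coordSet, mem_toList, mem_product, mem_univ, true_and, some_mem_insertNone,
    mem_biUnion]
  exact ⟨v, hc⟩

lemma sum_coords (σ : V × Option ℕ → ℝ) : (N.coords.map σ).sum =
    ∑ v, σ (v, none) + ∑ v, ∑ c ∈ univ.biUnion N.L, σ (v, some c) := by
  rw [coords, sum_map_toList, coordSet, sum_product, ← sum_add_distrib]
  exact sum_congr rfl fun v _ => sum_insertNone _ _

open Classical in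
/-- The neighbors of `u` with `c` in their list. -/
noncomputable def nbrs (u : V) (c : ℕ) : Finset V := {w | N.H.Adj u w ∧ c ∈ N.L w}

lemma mem_nbrs {u w : V} {c : ℕ} : w ∈ N.nbrs u c ↔ N.H.Adj u w ∧ c ∈ N.L w := by
  simp [nbrs]

lemma ne_of_mem_nbrs {u w : V} {c : ℕ} (h : w ∈ N.nbrs u c) : w ≠ u :=
  ((N.mem_nbrs).1 h).1.ne.symm

/-- Some neighbor of `u` receives the color `c`. -/
def Conflict (x : V × Option ℕ → Option ℕ) (u : V) (c : ℕ) : Prop :=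
  ∃ w ∈ N.nbrs u c, x (w, none) = some c

variable [DecidableEq V]

/-- The expectation over all random choices. -/
noncomputable def ex (f : (V × Option ℕ → Option ℕ) → ℝ) : ℝ :=
  N.weights.expect N.coords f fun _ => none

lemma ex_eq (f : (V × Option ℕ → Option ℕ) → ℝ) :
    N.ex f = N.weights.expect N.coords f fun _ => none := rfl

lemma ex_add (f g : (V × Option ℕ → Option ℕ) → ℝ) :
    N.ex (fun x => f x + g x) = N.ex f + N.ex g := by
  simp [ex, N.weights.expect_add]

lemma ex_sum {α : Type*} (s : Finset α) (f : α → (V × Option ℕ → Option ℕ) → ℝ) :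
    N.ex (fun x => ∑ a ∈ s, f a x) = ∑ a ∈ s, N.ex (f a) := by
  simp [ex, N.weights.expect_sum]

lemma ex_mono {f g : (V × Option ℕ → Option ℕ) → ℝ} (h : ∀ x, f x ≤ g x) : N.ex f ≤ N.ex g :=
  N.weights.expect_mono _ h _

lemma ex_mul {f g : (V × Option ℕ → Option ℕ) → ℝ} {A B : Set (V × Option ℕ)}
    (hf : DependsOn f A) (hg : DependsOn g B) (h : Disjoint A B) :
    N.ex (fun x => f x * g x) = N.ex f * N.ex g := by
  simp [ex, N.weights.expect_mul hf hg h]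

lemma ex_one_sub (f : (V × Option ℕ → Option ℕ) → ℝ) : N.ex (fun x => 1 - f x) = 1 - N.ex f := by
  simp only [ex, N.weights.expect_sub N.coords (fun _ => 1) f, N.weights.expect_const]

omit [Fintype V] [DecidableEq V] in
lemma dependsOn_propInd_coord (i : V × Option ℕ) (P : Option ℕ → Prop) :
    DependsOn (fun x : V × Option ℕ → Option ℕ => propInd (P (x i))) {i} := fun x y h => by
  simp only [h i rfl]

lemma ex_assigned {w : V} {c : ℕ} (hc : c ∈ N.L w) :
    N.ex (fun x => propInd (x (w, none) = some c)) = N.p / N.ℓ := by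
  rw [ex_eq, N.weights.expect_eq_avg (dependsOn_propInd_coord (w, none) (· = some c))
    (N.vertex_mem_coords w)]
  simp only [ProductWeights.avg, Function.update_self]
  change ∑ t ∈ insertNone (N.L w), _ = _
  rw [sum_insertNone, sum_eq_single_of_mem c hc]
  · rw [propInd_of_not (by simp), propInd_of rfl]
    simp [weights]
  · intro b _ hb
    rw [propInd_of_not (by simpa using hb), mul_zero]

lemma ex_not_activated (u : V) :
    N.ex (fun x => propInd (∀ c ∈ N.L u, x (u, none) ≠ some c)) = 1 - N.p := by
  rw [ex_eq, N.weights.expect_eq_avg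
    (dependsOn_propInd_coord (u, none) fun t => ∀ c ∈ N.L u, t ≠ some c) (N.vertex_mem_coords u)]
  simp only [ProductWeights.avg, Function.update_self]
  change ∑ t ∈ insertNone (N.L u), _ = _
  rw [sum_insertNone, sum_eq_zero, propInd_of (by simp)]
  · simp [weights]
  · intro c hc
    rw [propInd_of_not (fun h => h c hc rfl), mul_zero]

lemma ex_coin {u : V} {c : ℕ} (hc : c ∈ N.L u) :
    N.ex (fun x => propInd (x (u, some c) = none)) = N.β u c := by
  rw [ex_eq, N.weights.expect_eq_avg (dependsOn_propInd_coord (u, some c) (· = none))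
    (N.coin_mem_coords hc)]
  simp only [ProductWeights.avg, Function.update_self]
  change ∑ t ∈ {none, some 0}, _ = _
  rw [sum_pair (by simp), propInd_of rfl, propInd_of_not (by simp)]
  simp [weights]

lemma ex_none_assigned (W : Finset V) (c : ℕ) (hW : ∀ w ∈ W, c ∈ N.L w) :
    N.ex (fun x => propInd (∀ w ∈ W, x (w, none) ≠ some c)) = (1 - N.p / N.ℓ) ^ W.card := by
  simp only [propInd_forall]
  rw [ex_eq, N.weights.expect_prod N.coords W
    (fun w (x : V × Option ℕ → Option ℕ) => propInd (x (w, none) ≠ some c)) (fun w => {(w, none)})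
    (fun w _ => dependsOn_propInd_coord (w, none) (· ≠ some c))
    (fun a _ b _ hab => by simpa using hab)]
  change ∏ w ∈ W, N.ex (fun x => propInd (x (w, none) ≠ some c)) = _
  rw [← prod_const]
  refine prod_congr rfl fun w hw => ?_
  simp only [ne_eq, propInd_not, ex_one_sub, N.ex_assigned (hW w hw)]

omit [Fintype V] [DecidableEq V] in
lemma dependsOn_none_assigned (W : Finset V) (c : ℕ) :
    DependsOn (fun x : V × Option ℕ → Option ℕ => propInd (∀ w ∈ W, x (w, none) ≠ some c))
      {i | i.1 ∈ W ∧ i.2 = none} := fun x y h => by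
  have : (∀ w ∈ W, x (w, none) ≠ some c) ↔ ∀ w ∈ W, y (w, none) ≠ some c :=
    forall₂_congr fun w hw => by rw [h (w, none) ⟨hw, rfl⟩]
  simp only [this]

omit [DecidableEq V] in
lemma not_conflict_iff (x : V × Option ℕ → Option ℕ) (u : V) (c : ℕ) :
    ¬N.Conflict x u c ↔ ∀ w ∈ N.nbrs u c, x (w, none) ≠ some c := by
  simp [Conflict]

lemma ex_conflict (u : V) (c : ℕ) : N.ex (fun x => propInd (N.Conflict x u c)) =
    1 - (1 - N.p / N.ℓ) ^ (N.nbrs u c).card := by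
  rw [← N.ex_none_assigned _ c fun w hw => (N.mem_nbrs.1 hw).2, ← ex_one_sub]
  congr 1
  funext x
  rw [← propInd_not, ← not_conflict_iff, not_not]

/-- The number of colors that `v` keeps. -/
noncomputable def keptCount (v : V) (x : V × Option ℕ → Option ℕ) : ℝ :=
  ∑ c ∈ N.L v, propInd (x (v, some c) = none ∧ ¬N.Conflict x v c)

lemma ex_keptCount (v : V) : N.ex (N.keptCount v) =
    ∑ c ∈ N.L v, N.β v c * (1 - N.p / N.ℓ) ^ (N.nbrs v c).card := by
  unfold keptCount
  rw [ex_sum]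
  refine sum_congr rfl fun c hc => ?_
  simp only [propInd_and, not_conflict_iff]
  rw [N.ex_mul (dependsOn_propInd_coord (v, some c) (· = none)) (dependsOn_none_assigned _ c),
    N.ex_coin hc, N.ex_none_assigned _ c fun w hw => (N.mem_nbrs.1 hw).2]
  simp

/-- The number of vertices of `A` that are not activated, keep `c` in their coin flip and do not
have a vertex colored `c` in their outer neighborhood. -/
noncomputable def outerCount (A : Finset V) (c : ℕ) (O : V → Finset V)
    (x : V × Option ℕ → Option ℕ) : ℝ :=
  ∑ u ∈ A, propInd ((∀ c' ∈ N.L u, x (u, none) ≠ some c') ∧ x (u, some c) = none ∧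
    ∀ w ∈ O u, x (w, none) ≠ some c)

lemma ex_outerCount (A : Finset V) (c : ℕ) (O : V → Finset V) (hA : ∀ u ∈ A, c ∈ N.L u)
    (hO : ∀ u ∈ A, O u ⊆ N.nbrs u c) : N.ex (N.outerCount A c O) =
    ∑ u ∈ A, (1 - N.p) * (N.β u c * (1 - N.p / N.ℓ) ^ (O u).card) := by
  unfold outerCount
  rw [ex_sum]
  refine sum_congr rfl fun u hu => ?_
  simp only [propInd_and]
  have hdep : DependsOn (fun x : V × Option ℕ → Option ℕ => propInd (x (u, some c) = none) *
      propInd (∀ w ∈ O u, x (w, none) ≠ some c)) {i | i = (u, some c) ∨ (i.1 ∈ O u ∧ i.2 = none)} :=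
    fun x y h => congrArg₂ (· * ·)
      (dependsOn_propInd_coord (u, some c) (· = none) fun i hi => h i (Or.inl hi))
      (dependsOn_none_assigned (O u) c fun i hi => h i (Or.inr hi))
  rw [N.ex_mul (dependsOn_propInd_coord (u, none) fun t => ∀ c' ∈ N.L u, t ≠ some c') hdep,
    N.ex_mul (dependsOn_propInd_coord (u, some c) (· = none)) (dependsOn_none_assigned _ c),
    N.ex_not_activated, N.ex_coin (hA u hu),
    N.ex_none_assigned _ c fun w hw => (N.mem_nbrs.1 (hO u hu hw)).2]
  · simp
  · simp only [Set.disjoint_singleton_left, Set.mem_ofPred_eq, Prod.mk.injEq, true_and, and_true,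
      reduceCtorEq, false_or]
    exact fun h => N.ne_of_mem_nbrs (hO u hu h) rfl

/-- The number of vertices of `A` that receive a color and have a conflicting neighbor. -/
noncomputable def conflictCount (A : Finset V) (x : V × Option ℕ → Option ℕ) : ℝ :=
  ∑ u ∈ A, propInd (∃ c ∈ N.L u, x (u, none) = some c ∧ N.Conflict x u c)

/-- The number of vertices of `A` that receive the color `c` and have a conflicting neighbor. -/
noncomputable def colorConflictCount (A : Finset V) (c : ℕ) (x : V × Option ℕ → Option ℕ) : ℝ :=
  ∑ u ∈ A, propInd (c ∈ N.L u ∧ x (u, none) = some c ∧ N.Conflict x u c)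

/-- The number of vertices of `A` that receive the color `c`. -/
noncomputable def colorCount (A : Finset V) (c : ℕ) (x : V × Option ℕ → Option ℕ) : ℝ :=
  ∑ u ∈ A, propInd (c ∈ N.L u ∧ x (u, none) = some c)

/-- The number of conflicts, where every color contributes at most `K`. -/
noncomputable def truncConflictCount (A : Finset V) (K : ℝ) (x : V × Option ℕ → Option ℕ) : ℝ :=
  ∑ c ∈ A.biUnion N.L, min K (N.colorConflictCount A c x)

lemma ex_colorConflict_le {u : V} {c : ℕ} {q : ℝ}
    (hq : 1 - (1 - N.p / N.ℓ) ^ (N.nbrs u c).card ≤ q) :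
    N.ex (fun x => propInd (c ∈ N.L u ∧ x (u, none) = some c ∧ N.Conflict x u c)) ≤
      propInd (c ∈ N.L u) * (N.p / N.ℓ * q) := by
  by_cases hc : c ∈ N.L u
  · simp only [propInd_and, propInd_of hc, one_mul]
    have hdep : DependsOn (fun x : V × Option ℕ → Option ℕ => propInd (N.Conflict x u c))
        {i | i.1 ∈ N.nbrs u c ∧ i.2 = none} := by
      intro x y h
      have := dependsOn_none_assigned (N.nbrs u c) c h
      simp only [← not_conflict_iff, propInd_not] at this
      simpa using this
    rw [N.ex_mul (dependsOn_propInd_coord (u, none) (· = some c)) hdep, N.ex_assigned hc,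
      N.ex_conflict]
    · exact mul_le_mul_of_nonneg_left hq N.div_nonneg'
    · simp only [Set.disjoint_singleton_left, Set.mem_ofPred_eq, and_true]
      exact fun h => N.ne_of_mem_nbrs h rfl
  · simp [hc, propInd, ex, N.weights.expect_const]

omit [Fintype V] [DecidableEq V] in
lemma sum_propInd_mem_list {q : ℝ} (s : Finset ℕ) {u : V} (hu : N.L u ⊆ s) :
    ∑ c ∈ s, propInd (c ∈ N.L u) * (N.p / N.ℓ * q) = N.p * q := by
  rw [← sum_mul, sum_propInd, filter_mem_eq_inter, inter_eq_right.2 hu, N.card_L]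
  field_simp [N.ℓ_pos'.ne']

lemma ex_truncConflictCount_le (A : Finset V) (K q : ℝ)
    (hq : ∀ u ∈ A, ∀ c ∈ N.L u, 1 - (1 - N.p / N.ℓ) ^ (N.nbrs u c).card ≤ q) :
    N.ex (N.truncConflictCount A K) ≤ A.card * (N.p * q) := by
  calc N.ex (N.truncConflictCount A K)
      ≤ N.ex (fun x => ∑ c ∈ A.biUnion N.L, ∑ u ∈ A,
          propInd (c ∈ N.L u ∧ x (u, none) = some c ∧ N.Conflict x u c)) :=
        N.ex_mono fun x => sum_le_sum fun c _ => min_le_right _ _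
    _ = ∑ u ∈ A, ∑ c ∈ A.biUnion N.L,
          N.ex (fun x => propInd (c ∈ N.L u ∧ x (u, none) = some c ∧ N.Conflict x u c)) := by
        simp only [ex_sum]
        exact sum_comm
    _ ≤ ∑ u ∈ A, ∑ c ∈ A.biUnion N.L, propInd (c ∈ N.L u) * (N.p / N.ℓ * q) := by
        refine sum_le_sum fun u hu => sum_le_sum fun c _ => ?_
        by_cases hc : c ∈ N.L u
        · exact N.ex_colorConflict_le (hq u hu c hc)
        · simp [hc, propInd, ex, N.weights.expect_const]
    _ = _ := by
        rw [sum_congr rfl fun u hu => N.sum_propInd_mem_list _ (subset_biUnion_of_mem N.L hu),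
          sum_const, nsmul_eq_mul]

omit [DecidableEq V] in
lemma conflictCount_le (A : Finset V) (K : ℝ) (x : V × Option ℕ → Option ℕ)
    (hK : ∀ c ∈ A.biUnion N.L, N.colorCount A c x ≤ K) :
    N.conflictCount A x ≤ N.truncConflictCount A K x := by
  have h1 : ∀ c ∈ A.biUnion N.L, min K (N.colorConflictCount A c x) = N.colorConflictCount A c x :=
    fun c hc => min_eq_right ((sum_le_sum fun u _ =>
      propInd_mono fun h => ⟨h.1, h.2.1⟩).trans (hK c hc))
  rw [truncConflictCount, sum_congr rfl h1]
  unfold colorConflictCount conflictCount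
  rw [sum_comm]
  refine sum_le_sum fun u hu => ?_
  refine le_trans (propInd_mono ?_) (propInd_exists_le _ _)
  rintro ⟨c, hc, h⟩
  exact ⟨c, mem_biUnion.2 ⟨u, hu, hc⟩, hc, h⟩

omit [Fintype V] [DecidableEq V] in
lemma sum_vertex_weights (w : V) (g : Option ℕ → ℝ) :
    ∑ t ∈ N.weights.supp (w, none), N.weights.w (w, none) t * g t =
      (1 - N.p) * g none + N.p / N.ℓ * ∑ c ∈ N.L w, g (some c) := by
  change ∑ t ∈ insertNone (N.L w), _ = _
  rw [sum_insertNone, mul_sum]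
  rfl

/-- A tail bound for functions with small effects of the individual coordinates. -/
lemma ex_tail_le (f : (V × Option ℕ → Option ℕ) → ℝ) (r : V × Option ℕ → Option ℕ → ℝ)
    (a b m t V₀ : ℝ) (ha : 0 ≤ a) (hrb : ∀ i s, r i s ≤ b) (hab : a * b ≤ 1)
    (hf : ∀ i x, ∀ s ∈ N.weights.supp i,
      |f (Function.update x i s) - f (Function.update x i none)| ≤ r i s)
    (hV : ∑ v, ∑ s ∈ N.weights.supp (v, none), N.weights.w (v, none) s * r (v, none) s ^ 2 +
      ∑ v, ∑ c ∈ univ.biUnion N.L, ∑ s ∈ N.weights.supp (v, some c),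
        N.weights.w (v, some c) s * r (v, some c) s ^ 2 ≤ V₀)
    (hm : N.ex f ≤ m) :
    N.ex (fun x => propInd (m + t ≤ f x)) ≤ Real.exp (a ^ 2 * V₀ - a * t) := by
  have h := N.weights.expect_exp_le none f r a b hrb (by rwa [abs_of_nonneg ha]) N.coords
    (nodup_toList _) (fun _ => none) fun i _ x _ s hs => hf i x s hs
  rw [sum_coords] at h
  refine (N.weights.expect_propInd_le_of_exp N.coords f a m t _ _ ha hm h).trans ?_
  rw [Real.exp_le_exp]
  exact sub_le_sub_right (mul_le_mul_of_nonneg_left hV (sq_nonneg a)) _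

lemma conflict_update_vertex {x : V × Option ℕ → Option ℕ} {w u : V} {t : Option ℕ} {c : ℕ}
    (h : ¬(t = some c ∧ w ∈ N.nbrs u c)) :
    N.Conflict (Function.update x (w, none) t) u c ↔
      N.Conflict (Function.update x (w, none) none) u c := by
  unfold Conflict
  refine exists_congr fun v => and_congr_right fun hv => ?_
  by_cases hvw : v = w
  · subst hvw
    simp only [Function.update_self, reduceCtorEq, iff_false]
    exact fun ht => h ⟨ht, hv⟩
  · rw [Function.update_of_ne (by simpa using hvw), Function.update_of_ne (by simpa using hvw)]

lemma conflict_update_coin {x : V × Option ℕ → Option ℕ} {w u : V} {t : Option ℕ} {c c' : ℕ} :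
    N.Conflict (Function.update x (w, some c') t) u c ↔ N.Conflict x u c := by
  simp [Conflict]

lemma keptCount_tail (v : V) (B m t a : ℝ) (hB : ∀ c ∈ N.L v, ((N.nbrs v c).card : ℝ) ≤ B)
    (ha : 0 ≤ a) (ha1 : a ≤ 1) (hm : m ≤ N.ex (N.keptCount v)) :
    N.ex (fun x => propInd (N.keptCount v x ≤ m - t)) ≤
      Real.exp (a ^ 2 * (N.ℓ + N.p * B) - a * t) := by
  have hneg : N.ex (fun x => -1 * N.keptCount v x) = -1 * N.ex (N.keptCount v) := by
    simp only [ex, N.weights.expect_const_mul]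
  have hev : ∀ x, N.keptCount v x ≤ m - t ↔ -m + t ≤ -1 * N.keptCount v x := fun x => by
    constructor <;> intro h <;> linarith
  simp only [hev]
  refine N.ex_tail_le (fun x => -1 * N.keptCount v x) (fun i s => match i with
    | (w, none) => propInd (∃ c ∈ N.L v, s = some c ∧ w ∈ N.nbrs v c)
    | (w, some c') => propInd (∃ c ∈ N.L v, w = v ∧ c = c')) a 1 (-m) t _ ha ?_ (by linarith) ?_ ?_
    (by linarith)
  · rintro ⟨w, _ | c⟩ s <;> exact propInd_le_one _
  · rintro ⟨w, _ | c'⟩ x s -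
    · rw [← mul_sub, abs_mul, abs_neg, abs_one, one_mul]
      refine (abs_sum_propInd_sub_le _ _ _).trans
        (le_trans (sum_le_sum fun c hc => propInd_mono (Q := s = some c ∧ w ∈ N.nbrs v c) ?_)
          (sum_propInd_le_of_unique _ _ ?_))
      · contrapose!
        intro h
        rw [N.conflict_update_vertex (by simpa using h)]
        simp
      · rintro c₁ - c₂ - ⟨h1, -⟩ ⟨h2, -⟩
        exact Option.some_injective _ (h1.symm.trans h2)
    · rw [← mul_sub, abs_mul, abs_neg, abs_one, one_mul]
      refine (abs_sum_propInd_sub_le _ _ _).trans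
        (le_trans (sum_le_sum fun c hc => propInd_mono (Q := w = v ∧ c = c') ?_)
          (sum_propInd_le_of_unique _ _ ?_))
      · contrapose!
        intro h
        rw [N.conflict_update_coin, N.conflict_update_coin,
          Function.update_of_ne, Function.update_of_ne]
        all_goals
          simp only [ne_eq, Prod.mk.injEq, Option.some.injEq]
          exact fun h' => h h'.1.symm h'.2
      · rintro c₁ - c₂ - ⟨-, h1⟩ ⟨-, h2⟩
        exact h1.trans h2.symm
  · rw [add_comm]
    refine add_le_add ?_ ?_
    · calc _ = ∑ w, ∑ c ∈ univ.biUnion N.L, propInd (∃ c' ∈ N.L v, w = v ∧ c' = c) := by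
            refine sum_congr rfl fun w _ => sum_congr rfl fun c _ => ?_
            simp only [propInd_sq, ← sum_mul, N.weights.sum_one, one_mul]
        _ ≤ ∑ w, ∑ c ∈ univ.biUnion N.L, propInd (w ∈ ({v} : Finset V)) * propInd (c ∈ N.L v) := by
            refine sum_le_sum fun w _ => sum_le_sum fun c _ => ?_
            rw [← propInd_and]
            refine propInd_mono ?_
            rintro ⟨c', hc', hw, rfl⟩
            exact ⟨by simp [hw], hc'⟩
        _ ≤ ∑ w, propInd (w ∈ ({v} : Finset V)) * N.ℓ := by
            refine sum_le_sum fun w _ => ?_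
            rw [← mul_sum, ← N.card_L v]
            exact mul_le_mul_of_nonneg_left (sum_propInd_mem_le _ _) (propInd_nonneg _)
        _ ≤ _ := by
            rw [← sum_mul]
            have := sum_propInd_mem_le (univ : Finset V) {v}
            simp only [card_singleton, Nat.cast_one] at this
            exact mul_le_of_le_one_left N.ℓ_pos'.le this
    · calc _ ≤ ∑ w, N.p / N.ℓ * ∑ c ∈ N.L v, propInd (w ∈ N.nbrs v c) := by
            refine sum_le_sum fun w _ => ?_
            rw [sum_vertex_weights]
            simp only [propInd_sq]
            rw [propInd_of_not (by simp), mul_zero, zero_add]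
            refine mul_le_mul_of_nonneg_left ?_ N.div_nonneg'
            refine le_trans (sum_le_sum fun c _ => propInd_mono ?_)
              (sum_propInd_mem_and_le (N.L w) (N.L v) fun c => w ∈ N.nbrs v c)
            rintro ⟨c', hc', h, hw⟩
            obtain rfl := Option.some_injective _ h
            exact ⟨hc', hw⟩
        _ = N.p / N.ℓ * ∑ c ∈ N.L v, ∑ w, propInd (w ∈ N.nbrs v c) := by
            rw [← mul_sum, sum_comm]
        _ ≤ N.p / N.ℓ * ∑ c ∈ N.L v, B := by
            refine mul_le_mul_of_nonneg_left (sum_le_sum fun c hc => ?_) N.div_nonneg'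
            exact (sum_propInd_mem_le _ _).trans (hB c hc)
        _ = _ := by
            rw [sum_const, N.card_L, nsmul_eq_mul]
            field_simp [N.ℓ_pos'.ne']

omit [Fintype V] [DecidableEq V] in
lemma sum_weights_assigned_le (w : V) (c : ℕ) :
    ∑ s ∈ N.weights.supp (w, none), N.weights.w (w, none) s * propInd (s = some c) ≤
      N.p / N.ℓ := by
  rw [sum_vertex_weights, propInd_of_not (by simp), mul_zero, zero_add]
  refine mul_le_of_le_one_right N.div_nonneg' ?_
  refine (sum_propInd_le_of_unique _ _ ?_).trans (propInd_le_one _)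
  intro c₁ _ c₂ _ h1 h2
  exact Option.some_injective _ (h1.trans h2.symm)

lemma outerCount_tail (A : Finset V) (c : ℕ) (O : V → Finset V) (B D m t a : ℝ)
    (hB : 0 ≤ B) (hA : (A.card : ℝ) ≤ D) (hOc : ∀ u ∈ A, ((O u).card : ℝ) ≤ B * D)
    (hDℓ : D ≤ N.ℓ) (hmul : ∀ w, ((A.filter fun u => w ∈ O u).card : ℝ) ≤ B)
    (ha : 0 ≤ a) (hab : a * (1 + B) ≤ 1) (hm : N.ex (N.outerCount A c O) ≤ m) :
    N.ex (fun x => propInd (m + t ≤ N.outerCount A c O x)) ≤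
      Real.exp (a ^ 2 * ((1 + B) ^ 2 * (2 + B) * D) - a * t) := by
  refine N.ex_tail_le _ (fun i s => match i with
    | (w, none) => (1 + B) * propInd (w ∈ A ∨ (s = some c ∧ w ∈ A.biUnion O))
    | (w, some c') => (1 + B) * propInd (w ∈ A ∧ c' = c)) a (1 + B) m t _ ha ?_ hab ?_ ?_ hm
  · rintro ⟨w, _ | c⟩ s <;> exact mul_le_of_le_one_right (by linarith) (propInd_le_one _)
  · rintro ⟨w, _ | c'⟩ x s -
    · refine (abs_sum_propInd_sub_le _ _ _).trans ?_
      have h1 : ∀ u ∈ A, propInd (¬(((∀ c' ∈ N.L u, Function.update x (w, none) s (u, none) ≠ some c')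
          ∧ Function.update x (w, none) s (u, some c) = none ∧
            ∀ w' ∈ O u, Function.update x (w, none) s (w', none) ≠ some c) ↔
          ((∀ c' ∈ N.L u, Function.update x (w, none) none (u, none) ≠ some c')
          ∧ Function.update x (w, none) none (u, some c) = none ∧
            ∀ w' ∈ O u, Function.update x (w, none) none (w', none) ≠ some c))) ≤
          propInd (u = w) + propInd (w ∈ O u ∧ s = some c) := by
        intro u hu
        refine le_trans (propInd_mono ?_) (propInd_or_le _ _)
        contrapose!
        rintro ⟨h1, h2⟩
        have h3 : (∀ w' ∈ O u, Function.update x (w, none) s (w', none) ≠ some c) ↔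
            ∀ w' ∈ O u, Function.update x (w, none) none (w', none) ≠ some c := by
          refine forall₂_congr fun w' hw' => not_congr ?_
          by_cases hw : w' = w
          · subst hw
            simp [h2 hw']
          · rw [Function.update_of_ne (by simpa using hw), Function.update_of_ne (by simpa using hw)]
        rw [h3]
        simp [Function.update_apply, h1]
      refine (sum_le_sum h1).trans ?_
      change _ ≤ (1 + B) * propInd (w ∈ A ∨ (s = some c ∧ w ∈ A.biUnion O))
      by_cases hw : w ∈ A ∨ (s = some c ∧ w ∈ A.biUnion O)
      · rw [propInd_of hw, mul_one, sum_add_distrib]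
        refine add_le_add ?_ ?_
        · exact (sum_propInd_le_of_unique _ _ fun _ _ _ _ h1 h2 => h1.trans h2.symm).trans
            (propInd_le_one _)
        · refine le_trans (sum_le_sum fun u _ => propInd_mono And.left) ?_
          rw [sum_propInd]
          exact hmul w
      · rw [propInd_of_not hw, mul_zero]
        refine (sum_eq_zero fun u hu => ?_).le
        push Not at hw
        rw [propInd_of_not, propInd_of_not, add_zero]
        · rintro ⟨h1, h2⟩
          exact hw.2 h2 (mem_biUnion.2 ⟨u, hu, h1⟩)
        · rintro rfl
          exact hw.1 hu
    · refine (abs_sum_propInd_sub_le _ _ _).trans ?_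
      have h1 : ∀ u ∈ A, propInd (¬(((∀ c'' ∈ N.L u,
            Function.update x (w, some c') s (u, none) ≠ some c'')
          ∧ Function.update x (w, some c') s (u, some c) = none ∧
            ∀ w' ∈ O u, Function.update x (w, some c') s (w', none) ≠ some c) ↔
          ((∀ c'' ∈ N.L u, Function.update x (w, some c') none (u, none) ≠ some c'')
          ∧ Function.update x (w, some c') none (u, some c) = none ∧
            ∀ w' ∈ O u, Function.update x (w, some c') none (w', none) ≠ some c))) ≤
          propInd (u = w ∧ c' = c) := by
        intro u hu
        refine propInd_mono ?_
        contrapose!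
        intro h1
        have h2 : ((u, some c) : V × Option ℕ) ≠ (w, some c') := by
          simp only [ne_eq, Prod.mk.injEq, Option.some.injEq]
          exact fun h => h1 h.1 h.2.symm
        rw [Function.update_of_ne h2, Function.update_of_ne h2]
        simp
      refine (sum_le_sum h1).trans ?_
      refine (sum_propInd_le_of_unique _ _ fun _ _ _ _ h1 h2 => h1.1.trans h2.1.symm).trans ?_
      refine le_trans (propInd_mono ?_) (le_mul_of_one_le_left (propInd_nonneg _) (by linarith))
      rintro ⟨u, hu, rfl, h⟩
      exact ⟨hu, h⟩
  · have hD : 0 ≤ D := (Nat.cast_nonneg _).trans hA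
    have hcoin : ∑ v, ∑ c'' ∈ univ.biUnion N.L, ∑ s ∈ N.weights.supp (v, some c''),
        N.weights.w (v, some c'') s * ((1 + B) * propInd (v ∈ A ∧ c'' = c)) ^ 2 ≤
        (1 + B) ^ 2 * D := by
      calc _ = (1 + B) ^ 2 * ∑ v, ∑ c'' ∈ univ.biUnion N.L, propInd (v ∈ A ∧ c'' = c) := by
            simp only [mul_sum]
            refine sum_congr rfl fun w _ => sum_congr rfl fun c _ => ?_
            simp only [mul_pow, propInd_sq, ← sum_mul, N.weights.sum_one, one_mul]
        _ ≤ (1 + B) ^ 2 * ∑ v, propInd (v ∈ A) := by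
            refine mul_le_mul_of_nonneg_left (sum_le_sum fun w _ => ?_) (sq_nonneg _)
            refine (sum_propInd_le_of_unique _ _ fun _ _ _ _ h1 h2 => h1.2.trans h2.2.symm).trans
              (propInd_mono ?_)
            rintro ⟨_, _, h, _⟩
            exact h
        _ ≤ _ := mul_le_mul_of_nonneg_left ((sum_propInd_mem_le _ _).trans hA) (sq_nonneg _)
    have hvert : ∑ v, ∑ s ∈ N.weights.supp (v, none), N.weights.w (v, none) s *
        ((1 + B) * propInd (v ∈ A ∨ (s = some c ∧ v ∈ A.biUnion O))) ^ 2 ≤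
        (1 + B) ^ 2 * (D + B * D) := by
      have hU : ((A.biUnion O).card : ℝ) ≤ D * (B * D) := by
        calc ((A.biUnion O).card : ℝ) ≤ ∑ u ∈ A, ((O u).card : ℝ) := by
              exact_mod_cast card_biUnion_le
          _ ≤ ∑ u ∈ A, B * D := sum_le_sum hOc
          _ ≤ _ := by
              rw [sum_const, nsmul_eq_mul]
              exact mul_le_mul_of_nonneg_right hA (mul_nonneg hB hD)
      calc _ ≤ ∑ v, (1 + B) ^ 2 * (propInd (v ∈ A) + N.p / N.ℓ * propInd (v ∈ A.biUnion O)) := by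
            refine sum_le_sum fun v _ => ?_
            simp only [mul_pow, propInd_sq]
            calc _ ≤ ∑ s ∈ N.weights.supp (v, none), (1 + B) ^ 2 *
                  (N.weights.w (v, none) s * propInd (v ∈ A) +
                    (N.weights.w (v, none) s * propInd (s = some c)) * propInd (v ∈ A.biUnion O)) := by
                  refine sum_le_sum fun s hs => ?_
                  have h1 := propInd_or_le (v ∈ A) (s = some c ∧ v ∈ A.biUnion O)
                  rw [propInd_and] at h1
                  have h2 := mul_le_mul_of_nonneg_left h1
                    (mul_nonneg (sq_nonneg (1 + B)) (N.weights.nonneg _ s hs))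
                  linarith
              _ = (1 + B) ^ 2 * (1 * propInd (v ∈ A) + (∑ s ∈ N.weights.supp (v, none),
                    N.weights.w (v, none) s * propInd (s = some c)) * propInd (v ∈ A.biUnion O)) := by
                  rw [← mul_sum, sum_add_distrib, ← sum_mul, ← sum_mul, N.weights.sum_one]
              _ ≤ _ := by
                  rw [one_mul]
                  exact mul_le_mul_of_nonneg_left (add_le_add_right (mul_le_mul_of_nonneg_right
                    (N.sum_weights_assigned_le v c) (propInd_nonneg _)) _) (sq_nonneg _)
        _ = (1 + B) ^ 2 * (∑ v, propInd (v ∈ A) + N.p / N.ℓ * ∑ v, propInd (v ∈ A.biUnion O)) := by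
            rw [← mul_sum, sum_add_distrib, mul_sum]
        _ ≤ (1 + B) ^ 2 * (D + N.p / N.ℓ * (D * (B * D))) := by
            refine mul_le_mul_of_nonneg_left (add_le_add ((sum_propInd_mem_le _ _).trans hA) ?_)
              (sq_nonneg _)
            exact mul_le_mul_of_nonneg_left ((sum_propInd_mem_le _ _).trans hU) N.div_nonneg'
        _ ≤ _ := by
            refine mul_le_mul_of_nonneg_left (add_le_add_right ?_ _) (sq_nonneg _)
            have h1 : N.p / N.ℓ * D ≤ 1 := by
              rw [div_mul_eq_mul_div, div_le_one N.ℓ_pos']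
              exact (mul_le_of_le_one_left hD N.p_le_one).trans hDℓ
            calc N.p / N.ℓ * (D * (B * D)) = (N.p / N.ℓ * D) * (B * D) := by ring
              _ ≤ _ := mul_le_of_le_one_left (mul_nonneg hB hD) h1
    refine (add_le_add hvert hcoin).trans (le_of_eq ?_)
    ring

lemma colorCount_tail (A : Finset V) (c : ℕ) (D K : ℝ) (hA : (A.card : ℝ) ≤ D) (hDℓ : D ≤ N.ℓ) :
    N.ex (fun x => propInd (K ≤ N.colorCount A c x)) ≤ Real.exp (2 - K) := by
  have hD : 0 ≤ D := (Nat.cast_nonneg _).trans hA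
  have h1 : N.p / N.ℓ * D ≤ 1 := by
    rw [div_mul_eq_mul_div, div_le_one N.ℓ_pos']
    exact (mul_le_of_le_one_left hD N.p_le_one).trans hDℓ
  have hmean : N.ex (N.colorCount A c) ≤ 1 := by
    unfold colorCount
    rw [ex_sum]
    calc _ ≤ ∑ u ∈ A, N.p / N.ℓ := by
          refine sum_le_sum fun u _ => ?_
          by_cases hc : c ∈ N.L u
          · rw [← N.ex_assigned hc]
            exact N.ex_mono fun x => propInd_mono And.right
          · simp only [hc, false_and, propInd_of_not not_false, ex, N.weights.expect_const]
            exact N.div_nonneg'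
      _ = N.p / N.ℓ * A.card := by rw [sum_const, nsmul_eq_mul, mul_comm]
      _ ≤ _ := (mul_le_mul_of_nonneg_left hA N.div_nonneg').trans h1
  have h := N.ex_tail_le (N.colorCount A c) (fun i s => match i with
    | (w, none) => propInd (w ∈ A ∧ s = some c)
    | (_, some _) => 0) 1 1 1 (K - 1) 1 zero_le_one ?_ (by norm_num) ?_ ?_ hmean
  · rw [show (1 : ℝ) + (K - 1) = K by ring] at h
    refine h.trans_eq ?_
    congr 1
    ring
  · rintro ⟨w, _ | c⟩ s
    · exact propInd_le_one _
    · exact zero_le_one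
  · rintro ⟨w, _ | c'⟩ x s -
    · refine (abs_sum_propInd_sub_le _ _ _).trans
        (le_trans (sum_le_sum fun u hu => propInd_mono (Q := u = w ∧ s = some c) ?_) ?_)
      · contrapose!
        intro h
        simp only [Function.update_apply, Prod.mk.injEq, and_true]
        by_cases huw : u = w
        · simp [huw, h huw]
        · simp [huw]
      · refine (sum_propInd_le_of_unique _ _ fun _ _ _ _ h1 h2 => h1.1.trans h2.1.symm).trans
          (propInd_mono ?_)
        rintro ⟨u, hu, rfl, h⟩
        exact ⟨hu, h⟩
    · simp [colorCount]
  · simp only [ne_eq, OfNat.ofNat_ne_zero, not_false_eq_true, zero_pow, mul_zero, sum_const_zero,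
      add_zero, propInd_sq]
    simp only [propInd_and]
    calc _ ≤ ∑ v, propInd (v ∈ A) * (N.p / N.ℓ) := by
          refine sum_le_sum fun v _ => ?_
          calc _ = propInd (v ∈ A) * ∑ s ∈ N.weights.supp (v, none),
                N.weights.w (v, none) s * propInd (s = some c) := by
                rw [mul_sum]
                exact sum_congr rfl fun s _ => by ring
            _ ≤ _ := mul_le_mul_of_nonneg_left (N.sum_weights_assigned_le v c) (propInd_nonneg _)
      _ ≤ D * (N.p / N.ℓ) := by
          rw [← sum_mul]
          exact mul_le_mul_of_nonneg_right ((sum_propInd_mem_le _ _).trans hA) N.div_nonneg'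
      _ ≤ 1 := by rwa [mul_comm]

lemma truncConflictCount_update_vertex (A : Finset V) {K : ℝ} (hK : 0 ≤ K)
    (x : V × Option ℕ → Option ℕ) (w : V) (s : Option ℕ) :
    |N.truncConflictCount A K (Function.update x (w, none) s) -
      N.truncConflictCount A K (Function.update x (w, none) none)| ≤
      K * propInd (∃ c, s = some c ∧
        (w ∈ A ∨ ∃ u ∈ A, c ∈ N.L u ∧ w ∈ N.nbrs u c ∧ x (u, none) = some c)) := by
  have h0 : ∀ c y, 0 ≤ N.colorConflictCount A c y := fun c y =>
    sum_nonneg fun u _ => propInd_nonneg _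
  have h1 : ∀ c ∈ A.biUnion N.L,
      |min K (N.colorConflictCount A c (Function.update x (w, none) s)) -
        min K (N.colorConflictCount A c (Function.update x (w, none) none))| ≤
      K * propInd (s = some c ∧
        (w ∈ A ∨ ∃ u ∈ A, c ∈ N.L u ∧ w ∈ N.nbrs u c ∧ x (u, none) = some c)) := by
    intro c _
    by_cases h : s = some c ∧
        (w ∈ A ∨ ∃ u ∈ A, c ∈ N.L u ∧ w ∈ N.nbrs u c ∧ x (u, none) = some c)
    · rw [propInd_of h, mul_one, abs_le]
      have h1 := le_min hK (h0 c (Function.update x (w, none) s))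
      have h2 := le_min hK (h0 c (Function.update x (w, none) none))
      have h3 := min_le_left K (N.colorConflictCount A c (Function.update x (w, none) s))
      have h4 := min_le_left K (N.colorConflictCount A c (Function.update x (w, none) none))
      constructor <;> linarith
    · rw [propInd_of_not h, mul_zero]
      have heq : N.colorConflictCount A c (Function.update x (w, none) s) =
          N.colorConflictCount A c (Function.update x (w, none) none) := by
        refine sum_congr rfl fun u hu => congrArg propInd (propext ?_)
        refine and_congr_right fun hc => ?_
        by_cases hs : s = some c
        · simp only [hs, true_and, not_or, not_exists, not_and] at h
          have huw : ((u, none) : V × Option ℕ) ≠ (w, none) := by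
            rintro ⟨⟩
            exact h.1 hu
          rw [Function.update_of_ne huw, Function.update_of_ne huw]
          refine and_congr_right fun hx => N.conflict_update_vertex ?_
          exact fun hw => h.2 u hu hc hw.2 hx
        · rw [N.conflict_update_vertex fun hw => hs hw.1]
          refine and_congr_left fun _ => ?_
          by_cases huw : u = w
          · simp [huw, hs]
          · simp [huw]
      rw [heq, sub_self, abs_zero]
  unfold truncConflictCount
  rw [← sum_sub_distrib]
  refine (abs_sum_le_sum_abs _ _).trans ((sum_le_sum h1).trans ?_)
  rw [← mul_sum]
  refine mul_le_mul_of_nonneg_left ?_ hK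
  refine (sum_propInd_le_of_unique _ _ fun _ _ _ _ h1 h2 =>
    Option.some_injective _ (h1.1.symm.trans h2.1)).trans (propInd_mono ?_)
  rintro ⟨c, -, h⟩
  exact ⟨c, h⟩

lemma truncConflictCount_update_coin (A : Finset V) (K : ℝ) (x : V × Option ℕ → Option ℕ) (w : V)
    (c : ℕ) (s : Option ℕ) :
    N.truncConflictCount A K (Function.update x (w, some c) s) = N.truncConflictCount A K x := by
  simp [truncConflictCount, colorConflictCount, conflict_update_coin]

/-- Once the colors on `A` are revealed, only few outer vertices can create a new conflict. -/
lemma sum_conflict_influence_le (A : Finset V) (x : V × Option ℕ → Option ℕ) {B D : ℝ}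
    (hB : 0 ≤ B) (hA : (A.card : ℝ) ≤ D) (hDℓ : D ≤ N.ℓ)
    (hn : ∀ u ∈ A, ∀ c ∈ N.L u, ((N.nbrs u c).card : ℝ) ≤ B * D) :
    ∑ w, ∑ s ∈ N.weights.supp (w, none), N.weights.w (w, none) s *
      propInd (∃ c, s = some c ∧ ∃ u ∈ A, c ∈ N.L u ∧ w ∈ N.nbrs u c ∧ x (u, none) = some c) ≤
      B * D := by
  have hD : 0 ≤ D := (Nat.cast_nonneg _).trans hA
  have hu : ∀ u ∈ A, ∑ w, ∑ c ∈ N.L w,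
      propInd (c ∈ N.L u ∧ w ∈ N.nbrs u c ∧ x (u, none) = some c) ≤ B * D := by
    intro u hu
    by_cases h : ∃ c ∈ N.L u, x (u, none) = some c
    · obtain ⟨c₀, hc₀, h₀⟩ := h
      refine le_trans ?_ (hn u hu c₀ hc₀)
      refine le_trans (sum_le_sum fun w _ => ?_) (sum_propInd_mem_le univ (N.nbrs u c₀))
      refine (sum_propInd_le_of_unique _ _ fun _ _ _ _ h1 h2 =>
        Option.some_injective _ (h1.2.2.symm.trans h2.2.2)).trans (propInd_mono ?_)
      rintro ⟨c, -, -, hw, hc⟩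
      obtain rfl := Option.some_injective _ (h₀.symm.trans hc)
      exact hw
    · refine le_of_eq_of_le (sum_eq_zero fun w _ => sum_eq_zero fun c _ => propInd_of_not ?_)
        (mul_nonneg hB hD)
      exact fun hc => h ⟨c, hc.1, hc.2.2⟩
  calc _ ≤ ∑ w, N.p / N.ℓ * ∑ c ∈ N.L w, ∑ u ∈ A,
          propInd (c ∈ N.L u ∧ w ∈ N.nbrs u c ∧ x (u, none) = some c) := by
        refine sum_le_sum fun w _ => ?_
        rw [sum_vertex_weights, propInd_of_not (by simp), mul_zero, zero_add]
        refine mul_le_mul_of_nonneg_left (sum_le_sum fun c _ => ?_) N.div_nonneg'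
        refine le_trans (propInd_mono ?_) (propInd_exists_le _ _)
        rintro ⟨c', hc', h⟩
        obtain rfl := Option.some_injective _ hc'
        exact h
    _ = N.p / N.ℓ * ∑ u ∈ A, ∑ w, ∑ c ∈ N.L w,
          propInd (c ∈ N.L u ∧ w ∈ N.nbrs u c ∧ x (u, none) = some c) := by
        rw [← mul_sum, sum_comm (s := A)]
        exact congrArg _ (sum_congr rfl fun w _ => sum_comm)
    _ ≤ N.p / N.ℓ * ∑ u ∈ A, B * D := mul_le_mul_of_nonneg_left (sum_le_sum hu) N.div_nonneg'
    _ = (N.p / N.ℓ * A.card) * (B * D) := by rw [sum_const, nsmul_eq_mul]; ring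
    _ ≤ B * D := by
        refine mul_le_of_le_one_left (mul_nonneg hB hD) ?_
        rw [div_mul_eq_mul_div, div_le_one N.ℓ_pos']
        exact (mul_le_of_le_one_left (Nat.cast_nonneg _) N.p_le_one).trans (hA.trans hDℓ)

lemma truncConflictCount_tail (A : Finset V) (B D K m t a : ℝ) (hB : 0 ≤ B)
    (hA : (A.card : ℝ) ≤ D) (hDℓ : D ≤ N.ℓ)
    (hn : ∀ u ∈ A, ∀ c ∈ N.L u, ((N.nbrs u c).card : ℝ) ≤ B * D)
    (hK : 0 ≤ K) (ha : 0 ≤ a) (hab : a * K ≤ 1) (hm : N.ex (N.truncConflictCount A K) ≤ m) :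
    N.ex (fun x => propInd (m + t ≤ N.truncConflictCount A K x)) ≤
      Real.exp (a ^ 2 * (K ^ 2 * (1 + B) * D) - a * t) := by
  set s₁ : Finset (V × Option ℕ) := A.image fun u => (u, none) with hs₁
  set s₂ : Finset (V × Option ℕ) := N.coordSet \ s₁ with hs₂
  have hs₁s : s₁ ⊆ N.coordSet := by
    intro i hi
    obtain ⟨u, -, rfl⟩ := mem_image.1 hi
    exact mem_toList.1 (N.vertex_mem_coords u)
  have hnd : (s₁.toList ++ s₂.toList).Nodup := by
    refine List.nodup_append'.2 ⟨nodup_toList _, nodup_toList _, ?_⟩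
    intro i h1 h2
    exact (mem_sdiff.1 (mem_toList.1 h2)).2 (mem_toList.1 h1)
  have hperm : N.coords.Perm (s₁.toList ++ s₂.toList) := by
    refine List.perm_of_nodup_nodup_toFinset_eq (nodup_toList _) hnd ?_
    ext i
    simp only [coords, toList_toFinset, List.toFinset_append, mem_union, hs₂, mem_sdiff]
    constructor
    · intro h
      by_cases hi : i ∈ s₁ <;> simp [h, hi]
    · rintro (h | h)
      exacts [hs₁s h, h.1]
  have hbase : ∀ x, (∀ j, j ∉ s₁.toList → x j = (fun _ => none : V × Option ℕ → Option ℕ) j) →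
      N.weights.expect s₂.toList (fun y => Real.exp (a * N.truncConflictCount A K y)) x ≤
      Real.exp (a * N.weights.expect s₂.toList (N.truncConflictCount A K) x +
        a ^ 2 * (K ^ 2 * (B * D))) := by
    intro x _
    set r : V × Option ℕ → Option ℕ → ℝ := fun i s => match i with
      | (w, none) => K * propInd (∃ c, s = some c ∧
          ∃ u ∈ A, c ∈ N.L u ∧ w ∈ N.nbrs u c ∧ x (u, none) = some c)
      | (_, some _) => 0 with hr
    refine (N.weights.expect_exp_le none (N.truncConflictCount A K) r a K ?_
      (by rwa [abs_of_nonneg ha]) s₂.toList (nodup_toList _) x ?_).trans ?_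
    · rintro ⟨w, _ | c⟩ s
      exacts [mul_le_of_le_one_right hK (propInd_le_one _), hK]
    · rintro ⟨w, _ | c⟩ hi y hy s -
      · have hwA : w ∉ A := fun hw =>
          (mem_sdiff.1 (mem_toList.1 hi)).2 (mem_image_of_mem _ hw)
        refine (N.truncConflictCount_update_vertex A hK y w s).trans ?_
        refine mul_le_mul_of_nonneg_left (propInd_mono ?_) hK
        rintro ⟨c, hc, h | ⟨u, hu, hcu, hw, hyu⟩⟩
        · exact absurd h hwA
        · refine ⟨c, hc, u, hu, hcu, hw, ?_⟩
          rw [← hyu]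
          refine (hy _ fun h => ?_).symm
          exact (mem_sdiff.1 (mem_toList.1 h)).2 (mem_image_of_mem _ hu)
      · simp [truncConflictCount_update_coin, hr]
    · rw [Real.exp_le_exp]
      refine add_le_add_right (mul_le_mul_of_nonneg_left ?_ (sq_nonneg a)) _
      have hσ : ∀ i, 0 ≤ ∑ s ∈ N.weights.supp i, N.weights.w i s * r i s ^ 2 := fun i =>
        sum_nonneg fun s hs => mul_nonneg (N.weights.nonneg i s hs) (sq_nonneg _)
      rw [sum_map_toList]
      refine (sum_le_sum_of_subset_of_nonneg sdiff_subset fun i _ _ => hσ i).trans ?_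
      rw [← sum_map_toList]
      refine (N.sum_coords _).trans_le ?_
      simp only [hr, ne_eq, OfNat.ofNat_ne_zero, not_false_eq_true, zero_pow, mul_zero,
        sum_const_zero, add_zero, mul_pow, propInd_sq]
      simp only [mul_left_comm _ (K ^ 2), ← mul_sum]
      exact mul_le_mul_of_nonneg_left (N.sum_conflict_influence_le A x hB hA hDℓ hn) (sq_nonneg K)
  have hmain := N.weights.expect_exp_le_append none (N.truncConflictCount A K) (fun _ _ => K) a K
    (K ^ 2 * (B * D)) (fun _ _ => le_rfl) (by rwa [abs_of_nonneg ha]) s₁.toList s₂.toList hnd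
    (fun _ => none) (fun i hi y _ s _ => by
      obtain ⟨u, -, rfl⟩ := mem_image.1 (mem_toList.1 hi)
      exact (N.truncConflictCount_update_vertex A hK y u s).trans
        (mul_le_of_le_one_right hK (propInd_le_one _))) hbase
  rw [← N.weights.expect_perm hperm, ← N.weights.expect_perm hperm] at hmain
  refine (N.weights.expect_propInd_le_of_exp N.coords _ a m t _ _ ha hm hmain).trans ?_
  rw [Real.exp_le_exp]
  refine sub_le_sub_right (mul_le_mul_of_nonneg_left ?_ (sq_nonneg a)) _
  simp only [← sum_mul, N.weights.sum_one, one_mul]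
  rw [sum_map_toList, sum_const, nsmul_eq_mul]
  have hcard : (s₁.card : ℝ) ≤ D := le_trans (by exact_mod_cast card_image_le) hA
  nlinarith [mul_le_mul_of_nonneg_right hcard (sq_nonneg K)]

lemma conflictCount_tail (A : Finset V) (B D K m t a : ℝ) (hB : 0 ≤ B)
    (hA : (A.card : ℝ) ≤ D) (hDℓ : D ≤ N.ℓ)
    (hn : ∀ u ∈ A, ∀ c ∈ N.L u, ((N.nbrs u c).card : ℝ) ≤ B * D)
    (hK : 0 ≤ K) (ha : 0 ≤ a) (hab : a * K ≤ 1) (hm : N.ex (N.truncConflictCount A K) ≤ m) :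
    N.ex (fun x => propInd (m + t ≤ N.conflictCount A x)) ≤
      Real.exp (a ^ 2 * (K ^ 2 * (1 + B) * D) - a * t) + D * N.ℓ * Real.exp (2 - K) := by
  have hpt : ∀ x, propInd (m + t ≤ N.conflictCount A x) ≤
      propInd (m + t ≤ N.truncConflictCount A K x) +
        ∑ c ∈ A.biUnion N.L, propInd (K ≤ N.colorCount A c x) := by
    intro x
    refine le_trans (propInd_mono ?_) ((propInd_or_le _ _).trans
      (add_le_add_right (propInd_exists_le _ _) _))
    intro h
    by_contra! hc
    exact (hc.1.trans_le h).not_ge (N.conflictCount_le A K x fun c hcA => (hc.2 c hcA).le)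
  refine (N.ex_mono hpt).trans ?_
  rw [ex_add, ex_sum]
  refine add_le_add (N.truncConflictCount_tail A B D K m t a hB hA hDℓ hn hK ha hab hm) ?_
  refine (sum_le_sum fun c _ => N.colorCount_tail A c D K hA hDℓ).trans ?_
  rw [sum_const, nsmul_eq_mul]
  refine mul_le_mul_of_nonneg_right ?_ (Real.exp_pos _).le
  calc ((A.biUnion N.L).card : ℝ) ≤ ∑ u ∈ A, ((N.L u).card : ℝ) := by
        exact_mod_cast card_biUnion_le
    _ = A.card * N.ℓ := by simp [N.card_L]
    _ ≤ _ := mul_le_mul_of_nonneg_right hA N.ℓ_pos'.le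

open Classical in
/-- The vertex `v` and its neighbors with which it shares a color. -/
noncomputable def ball (v : V) : Finset V := insert v ((N.L v).biUnion fun c => N.nbrs v c)

lemma self_mem_ball (v : V) : v ∈ N.ball v := by simp [ball]

lemma mem_ball_of_mem_nbrs {v u : V} {c : ℕ} (hc : c ∈ N.L v) (hu : u ∈ N.nbrs v c) :
    u ∈ N.ball v :=
  mem_insert_of_mem (mem_biUnion.2 ⟨c, hc, hu⟩)

lemma mem_ball_symm {u v : V} (h : u ∈ N.ball v) : v ∈ N.ball u := by
  obtain rfl | h := mem_insert.1 h
  · exact N.self_mem_ball _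
  · obtain ⟨c, hc, hu⟩ := mem_biUnion.1 h
    exact N.mem_ball_of_mem_nbrs (N.mem_nbrs.1 hu).2 (N.mem_nbrs.2 ⟨(N.mem_nbrs.1 hu).1.symm, hc⟩)

lemma card_ball_le {d : ℝ} (hd : ∀ v, ∀ c ∈ N.L v, ((N.nbrs v c).card : ℝ) ≤ d) (v : V) :
    ((N.ball v).card : ℝ) ≤ 1 + N.ℓ * d := by
  have h1 : ((N.ball v).card : ℝ) ≤ ((N.L v).biUnion fun c => N.nbrs v c).card + 1 := by
    exact_mod_cast card_insert_le _ _
  have h2 : (((N.L v).biUnion fun c => N.nbrs v c).card : ℝ) ≤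
      ∑ c ∈ N.L v, ((N.nbrs v c).card : ℝ) := by
    exact_mod_cast card_biUnion_le
  have h3 : ∑ c ∈ N.L v, ((N.nbrs v c).card : ℝ) ≤ ∑ c ∈ N.L v, d :=
    sum_le_sum fun c hc => hd v c hc
  rw [sum_const, N.card_L, nsmul_eq_mul] at h3
  linarith

/-- The local lemma for events determined by the choices in the second neighborhood. -/
lemma exists_forall_not (bad : V → (V × Option ℕ → Option ℕ) → Prop)
    (hloc : ∀ v x y, (∀ i : V × Option ℕ, i.1 ∈ (N.ball v).biUnion N.ball → x i = y i) →
      (bad v x ↔ bad v y))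
    (d q : ℝ) (hd0 : 0 ≤ d) (hd : ∀ v, ∀ c ∈ N.L v, ((N.nbrs v c).card : ℝ) ≤ d) (hq : 0 ≤ q)
    (hbad : ∀ v, N.ex (fun x => propInd (bad v x)) ≤ q) (hdq : 4 * q * (1 + N.ℓ * d) ^ 4 ≤ 1) :
    ∃ x, ∀ v, ¬bad v x := by
  have hD : (1 : ℝ) ≤ 1 + N.ℓ * d := by
    have := mul_nonneg N.ℓ_pos'.le hd0
    linarith
  have hcard : ∀ s : Finset V, ((s.biUnion N.ball).card : ℝ) ≤ s.card * (1 + N.ℓ * d) := by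
    intro s
    calc ((s.biUnion N.ball).card : ℝ) ≤ ∑ u ∈ s, ((N.ball u).card : ℝ) := by
          exact_mod_cast card_biUnion_le
      _ ≤ ∑ u ∈ s, (1 + N.ℓ * d) := sum_le_sum fun u _ => N.card_ball_le hd u
      _ = _ := by rw [sum_const, nsmul_eq_mul]
  refine N.weights.exists_forall_not_of_local N.coords (fun _ => none) bad
    (fun v => {i | i.1 ∈ (N.ball v).biUnion N.ball}) hloc
    (fun v => (((N.ball v).biUnion N.ball).biUnion N.ball).biUnion N.ball) ?_
    ((1 + N.ℓ * d) ^ 4) q (one_le_pow₀ hD) ?_ hq hbad hdq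
  · intro v v' hv'
    rw [Set.disjoint_left]
    intro i hi hi'
    obtain ⟨u, hu, hui⟩ := mem_biUnion.1 hi'
    exact hv' (mem_biUnion.2 ⟨u, mem_biUnion.2 ⟨i.1, hi, N.mem_ball_symm hui⟩, N.mem_ball_symm hu⟩)
  · intro v
    have h1 := N.card_ball_le hd v
    have h2 := hcard (N.ball v)
    have h3 := hcard ((N.ball v).biUnion N.ball)
    have h4 := hcard (((N.ball v).biUnion N.ball).biUnion N.ball)
    have h0 : 0 ≤ 1 + N.ℓ * d := by linarith
    calc _ ≤ _ := h4
      _ ≤ (((1 + N.ℓ * d) * (1 + N.ℓ * d)) * (1 + N.ℓ * d)) * (1 + N.ℓ * d) := by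
          refine mul_le_mul_of_nonneg_right (h3.trans ?_) h0
          refine mul_le_mul_of_nonneg_right (h2.trans ?_) h0
          exact mul_le_mul_of_nonneg_right h1 h0
      _ = _ := by ring

lemma conflict_congr {v : V} {c : ℕ} {x y : V × Option ℕ → Option ℕ} (hc : c ∈ N.L v)
    (h : ∀ i : V × Option ℕ, i.1 ∈ N.ball v → x i = y i) : N.Conflict x v c ↔ N.Conflict y v c :=
  exists_congr fun w => and_congr_right fun hw => by
    rw [h (w, none) (N.mem_ball_of_mem_nbrs hc hw)]

lemma keptCount_congr {v : V} {x y : V × Option ℕ → Option ℕ}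
    (h : ∀ i : V × Option ℕ, i.1 ∈ N.ball v → x i = y i) : N.keptCount v x = N.keptCount v y :=
  sum_congr rfl fun c hc => congrArg propInd (propext (by
    rw [N.conflict_congr hc h, h (v, some c) (N.self_mem_ball v)]))

lemma outerCount_congr {A : Finset V} {c : ℕ} {O : V → Finset V} {x y : V × Option ℕ → Option ℕ}
    (hA : ∀ u ∈ A, c ∈ N.L u) (hO : ∀ u ∈ A, O u ⊆ N.nbrs u c)
    (h : ∀ i : V × Option ℕ, i.1 ∈ A.biUnion N.ball → x i = y i) :
    N.outerCount A c O x = N.outerCount A c O y := by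
  refine sum_congr rfl fun u hu => congrArg propInd (propext ?_)
  have h' : ∀ w ∈ N.ball u, ∀ o, x (w, o) = y (w, o) := fun w hw o =>
    h (w, o) (mem_biUnion.2 ⟨u, hu, hw⟩)
  have h1 : (∀ w ∈ O u, x (w, none) ≠ some c) ↔ ∀ w ∈ O u, y (w, none) ≠ some c :=
    forall₂_congr fun w hw => by rw [h' w (N.mem_ball_of_mem_nbrs (hA u hu) (hO u hu hw))]
  rw [h1, h' u (N.self_mem_ball u), h' u (N.self_mem_ball u)]

lemma conflictCount_congr {A : Finset V} {x y : V × Option ℕ → Option ℕ}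
    (h : ∀ i : V × Option ℕ, i.1 ∈ A.biUnion N.ball → x i = y i) :
    N.conflictCount A x = N.conflictCount A y := by
  refine sum_congr rfl fun u hu => congrArg propInd (propext ?_)
  have h' : ∀ i : V × Option ℕ, i.1 ∈ N.ball u → x i = y i := fun i hi =>
    h i (mem_biUnion.2 ⟨u, hu, hi⟩)
  refine exists_congr fun c => and_congr_right fun hc => ?_
  rw [N.conflict_congr hc h', h' (u, none) (N.self_mem_ball u)]

open Classical in
/-- The vertices of `W` that are activated and have no conflict. -/
noncomputable def colored (W : Finset V) (x : V × Option ℕ → Option ℕ) : Finset V :=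
  {u ∈ W | ∃ c ∈ N.L u, x (u, none) = some c ∧ ¬N.Conflict x u c}

open Classical in
/-- The colors that `v` keeps. -/
noncomputable def kept (v : V) (x : V × Option ℕ → Option ℕ) : Finset ℕ :=
  {c ∈ N.L v | x (v, some c) = none ∧ ¬N.Conflict x v c}

omit [DecidableEq V] in
lemma colored_subset (W : Finset V) (x : V × Option ℕ → Option ℕ) : N.colored W x ⊆ W := by
  classical
  exact filter_subset _ _

omit [DecidableEq V] in
lemma keptCount_eq_card (v : V) (x : V × Option ℕ → Option ℕ) :
    N.keptCount v x = (N.kept v x).card := by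
  classical
  exact sum_propInd _ _

omit [DecidableEq V] in
lemma kept_subset (v : V) (x : V × Option ℕ → Option ℕ) : N.kept v x ⊆ N.L v := by
  classical
  exact filter_subset _ _

omit [DecidableEq V] in
lemma exists_color {W : Finset V} {x : V × Option ℕ → Option ℕ} {u : V} (hu : u ∈ N.colored W x) :
    ∃ c ∈ N.L u, x (u, none) = some c ∧ ¬N.Conflict x u c := by
  classical
  exact (mem_filter.1 hu).2

omit [DecidableEq V] in
lemma color_spec {W : Finset V} {x : V × Option ℕ → Option ℕ} {u : V} (hu : u ∈ N.colored W x) :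
    (x (u, none)).getD 0 ∈ N.L u ∧ x (u, none) = some ((x (u, none)).getD 0) ∧
      ¬N.Conflict x u ((x (u, none)).getD 0) := by
  obtain ⟨c, hc, hx, h⟩ := N.exists_color hu
  simp [hx, hc, h]

omit [DecidableEq V] in
lemma color_ne {W : Finset V} {x : V × Option ℕ → Option ℕ} {u v : V} {c : ℕ}
    (hu : u ∈ N.colored W x) (hadj : N.H.Adj v u) (hv : ¬N.Conflict x v c) :
    (x (u, none)).getD 0 ≠ c := by
  rintro rfl
  obtain ⟨h1, h2, -⟩ := N.color_spec hu
  exact hv ⟨u, N.mem_nbrs.2 ⟨hadj, h1⟩, h2⟩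

omit [DecidableEq V] in
lemma not_conflict_of_mem_kept {x : V × Option ℕ → Option ℕ} {v : V} {c : ℕ}
    (hc : c ∈ N.kept v x) : c ∈ N.L v ∧ x (v, some c) = none ∧ ¬N.Conflict x v c := by
  classical
  exact mem_filter.1 hc

omit [DecidableEq V] in
lemma card_uncolored_le {W A R : Finset V} {c : ℕ} {O : V → Finset V}
    {x : V × Option ℕ → Option ℕ} (hO : ∀ u ∈ A, O u ⊆ N.nbrs u c)
    (hR : ∀ u ∈ R, u ∈ A ∧ u ∈ W ∧ u ∉ N.colored W x ∧ c ∈ N.kept u x) :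
    (R.card : ℝ) ≤ N.outerCount A c O x + N.conflictCount A x := by
  classical
  calc (R.card : ℝ) = ∑ u ∈ R, 1 := by simp
    _ ≤ ∑ u ∈ R, (propInd ((∀ c' ∈ N.L u, x (u, none) ≠ some c') ∧ x (u, some c) = none ∧
          ∀ w ∈ O u, x (w, none) ≠ some c) +
        propInd (∃ c ∈ N.L u, x (u, none) = some c ∧ N.Conflict x u c)) := by
        refine sum_le_sum fun u hu => ?_
        obtain ⟨huA, huW, hu, hk⟩ := hR u hu
        obtain ⟨hc, h1, h2⟩ := N.not_conflict_of_mem_kept hk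
        rw [not_conflict_iff] at h2
        by_cases h : ∀ c' ∈ N.L u, x (u, none) ≠ some c'
        · rw [propInd_of ⟨h, h1, fun w hw => h2 w (hO u huA hw)⟩]
          exact le_add_of_nonneg_right (propInd_nonneg _)
        · push Not at h
          obtain ⟨c', hc', hx⟩ := h
          have hP : ∃ c ∈ N.L u, x (u, none) = some c ∧ N.Conflict x u c :=
            ⟨c', hc', hx, by_contra fun h => hu (mem_filter.2 ⟨huW, c', hc', hx, h⟩)⟩
          rw [propInd_of hP]
          exact le_add_of_nonneg_left (propInd_nonneg _)
    _ ≤ ∑ u ∈ A, (propInd ((∀ c' ∈ N.L u, x (u, none) ≠ some c') ∧ x (u, some c) = none ∧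
          ∀ w ∈ O u, x (w, none) ≠ some c) +
        propInd (∃ c ∈ N.L u, x (u, none) = some c ∧ N.Conflict x u c)) :=
        sum_le_sum_of_subset_of_nonneg (fun u hu => (hR u hu).1) fun u _ _ =>
          add_nonneg (propInd_nonneg _) (propInd_nonneg _)
    _ = _ := sum_add_distrib

lemma rpow_le_pow_of_le {z z' E : ℝ} {k : ℕ} (hz : 0 < z) (hz1 : z ≤ 1) (hzz' : z ≤ z')
    (hk : (k : ℝ) ≤ E) : z ^ E ≤ z' ^ k :=
  calc z ^ E ≤ z ^ (k : ℝ) := Real.rpow_le_rpow_of_exponent_ge hz hz1 hk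
    _ = z ^ k := Real.rpow_natCast _ _
    _ ≤ z' ^ k := pow_le_pow_left₀ hz.le hzz' k

lemma le_ex_keptCount {ζ : ℝ} {Λ : ℝ} (hΛℓ : Λ ≤ N.ℓ) (hζ : 0 ≤ ζ)
    (hβ : ∀ u, ∀ c ∈ N.L u, N.β u c * (1 - N.p / N.ℓ) ^ (N.nbrs u c).card = ζ) (v : V) :
    ζ * Λ ≤ N.ex (N.keptCount v) := by
  rw [ex_keptCount, sum_congr rfl fun c hc => hβ v c hc, sum_const, N.card_L, nsmul_eq_mul,
    mul_comm]
  exact mul_le_mul_of_nonneg_right hΛℓ hζ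

open Classical in
/-- The neighbors of `v` in `G` with `c` in their list. -/
noncomputable def innerNbrs (G : SimpleGraph V) (v : V) (c : ℕ) : Finset V :=
  {u | G.Adj v u ∧ c ∈ N.L u}

omit [DecidableEq V] in
lemma mem_innerNbrs {G : SimpleGraph V} {v u : V} {c : ℕ} :
    u ∈ N.innerNbrs G v c ↔ G.Adj v u ∧ c ∈ N.L u := by
  simp [innerNbrs]

open Classical in
/-- The neighbors of `v` outside of `G` with `c` in their list. -/
noncomputable def outerNbrs (G : SimpleGraph V) (c : ℕ) (v : V) : Finset V :=
  {u ∈ N.nbrs v c | ¬G.Adj v u}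

omit [DecidableEq V] in
lemma mem_outerNbrs {G : SimpleGraph V} {v u : V} {c : ℕ} :
    u ∈ N.outerNbrs G c v ↔ (N.H.Adj v u ∧ c ∈ N.L u) ∧ ¬G.Adj v u := by
  simp [outerNbrs, mem_nbrs]

omit [DecidableEq V] in
lemma outerNbrs_subset (G : SimpleGraph V) (c : ℕ) (v : V) : N.outerNbrs G c v ⊆ N.nbrs v c := by
  classical
  exact filter_subset _ _

/-- The graph of `N` is the union of nearly disjoint graphs `G i` on vertex sets `S i` with color
degrees at most `D`, and every vertex is in at most `C` of the sets `S i`. -/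
structure IsUnion {m : ℕ} (G : Fin m → SimpleGraph V) (S : Fin m → Finset V) (C D : ℝ) : Prop where
  H_eq : N.H = ⨆ i, G i
  mem_of_adj : ∀ i u v, (G i).Adj u v → u ∈ S i ∧ v ∈ S i
  card_inter_le : ∀ i j, i ≠ j → (S i ∩ S j).card ≤ 1
  card_filter_le : ∀ v, ((univ.filter fun i => v ∈ S i).card : ℝ) ≤ C
  card_innerNbrs_le : ∀ i, ∀ v ∈ S i, ∀ c ∈ N.L v, ((N.innerNbrs (G i) v c).card : ℝ) ≤ D

namespace IsUnion

variable {N} {m : ℕ} {G : Fin m → SimpleGraph V} {S : Fin m → Finset V} {C D : ℝ}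
  (h : N.IsUnion G S C D)
include h

lemma exists_adj {u v : V} : N.H.Adj u v ↔ ∃ i, (G i).Adj u v := by
  rw [h.H_eq, SimpleGraph.iSup_adj]

lemma card_nbrs_le (hD : 0 ≤ D) (v : V) (c : ℕ) (hc : c ∈ N.L v) :
    ((N.nbrs v c).card : ℝ) ≤ C * D := by
  have hsub : N.nbrs v c ⊆
      (univ.filter fun i => v ∈ S i).biUnion fun i => N.innerNbrs (G i) v c := by
    intro u hu
    rw [mem_nbrs, h.exists_adj] at hu
    obtain ⟨⟨i, hi⟩, hcu⟩ := hu
    exact mem_biUnion.2 ⟨i, by simpa using (h.mem_of_adj i _ _ hi).1, N.mem_innerNbrs.2 ⟨hi, hcu⟩⟩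
  calc ((N.nbrs v c).card : ℝ)
      ≤ ((univ.filter fun i => v ∈ S i).biUnion fun i => N.innerNbrs (G i) v c).card := by
        exact_mod_cast card_le_card hsub
    _ ≤ ∑ i with v ∈ S i, ((N.innerNbrs (G i) v c).card : ℝ) := by
        exact_mod_cast card_biUnion_le
    _ ≤ ∑ i with v ∈ S i, D := sum_le_sum fun i hi =>
        h.card_innerNbrs_le i v (by simpa using hi) c hc
    _ ≤ C * D := by
        rw [sum_const, nsmul_eq_mul]
        exact mul_le_mul_of_nonneg_right (h.card_filter_le v) hD

lemma exists_card_nbrs_eq (i : Fin m) {u : V} (hu : u ∈ S i) {c : ℕ} (hc : c ∈ N.L u) :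
    ∃ k : ℕ, (k : ℝ) ≤ D ∧ (N.nbrs u c).card = (N.outerNbrs (G i) c u).card + k := by
  classical
  refine ⟨((N.nbrs u c).filter fun w => (G i).Adj u w).card, ?_, ?_⟩
  · refine le_trans ?_ (h.card_innerNbrs_le i u hu c hc)
    exact_mod_cast card_le_card fun w hw => by
      rw [mem_filter, mem_nbrs] at hw
      exact N.mem_innerNbrs.2 ⟨hw.2, hw.1.2⟩
  · rw [add_comm, outerNbrs]
    exact (card_filter_add_card_filter_not _).symm

lemma card_common_le (i : Fin m) (v w : V) (c : ℕ) :
    (((N.innerNbrs (G i) v c).filter fun u => w ∈ N.outerNbrs (G i) c u).card : ℝ) ≤ C := by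
  classical
  refine le_trans ?_ (h.card_filter_le w)
  have hj : ∀ u ∈ (N.innerNbrs (G i) v c).filter fun u => w ∈ N.outerNbrs (G i) c u,
      u ∈ S i ∧ ∃ j, j ≠ i ∧ u ∈ S j ∧ w ∈ S j := by
    intro u hu
    rw [mem_filter, mem_innerNbrs, mem_outerNbrs, h.exists_adj] at hu
    obtain ⟨⟨h1, -⟩, ⟨⟨j, hj⟩, -⟩, h3⟩ := hu
    refine ⟨(h.mem_of_adj i _ _ h1).2, j, ?_, h.mem_of_adj j _ _ hj⟩
    rintro rfl
    exact h3 hj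
  have : Nonempty (Fin m) := ⟨i⟩
  choose! f hf using fun u hu => (hj u hu).2
  norm_cast
  refine card_le_card_of_injOn f (fun u hu => ?_) fun u hu u' hu' huu' => ?_
  · simpa using (hf u hu).2.2
  · refine card_le_one.1 (h.card_inter_le i (f u) (hf u hu).1.symm) u ?_ u' ?_
    · exact mem_inter.2 ⟨(hj u hu).1, (hf u hu).2.1⟩
    · exact mem_inter.2 ⟨(hj u' hu').1, huu' ▸ (hf u' hu').2.1⟩

lemma ex_outerCount_le {z : ℝ} (hz : 0 < z) (hz1 : z ≤ 1) (hzN : z ≤ 1 - N.p / N.ℓ)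
    (hβ : ∀ u, ∀ c ∈ N.L u, N.β u c * (1 - N.p / N.ℓ) ^ (N.nbrs u c).card = z ^ (D * C))
    (i : Fin m) {v : V} (hv : v ∈ S i) {c : ℕ} (hc : c ∈ N.L v) :
    N.ex (N.outerCount (N.innerNbrs (G i) v c) c (N.outerNbrs (G i) c)) ≤
      D * ((1 - N.p) * z ^ (D * (C - 1))) := by
  have hp := sub_nonneg.2 N.p_le_one
  rw [N.ex_outerCount _ c _ (fun u hu => (N.mem_innerNbrs.1 hu).2)
    fun u _ => N.outerNbrs_subset _ _ _]
  calc _ ≤ ∑ u ∈ N.innerNbrs (G i) v c, (1 - N.p) * z ^ (D * (C - 1)) := by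
        refine sum_le_sum fun u hu => mul_le_mul_of_nonneg_left ?_ hp
        obtain ⟨hadj, hcu⟩ := N.mem_innerNbrs.1 hu
        obtain ⟨k, hk, hcard⟩ := h.exists_card_nbrs_eq i (h.mem_of_adj i _ _ hadj).2 hcu
        have h1 := hβ u c hcu
        rw [hcard, pow_add, ← mul_assoc] at h1
        rw [mul_sub, mul_one, Real.rpow_sub hz, ← h1, le_div_iff₀ (Real.rpow_pos_of_pos hz D)]
        exact mul_le_mul_of_nonneg_left (rpow_le_pow_of_le hz hz1 hzN hk)
          (mul_nonneg (N.β_nonneg _ _) (pow_nonneg (hz.le.trans hzN) _))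
    _ ≤ _ := by
        rw [sum_const, nsmul_eq_mul]
        exact mul_le_mul_of_nonneg_right (h.card_innerNbrs_le i v hv c hc)
          (mul_nonneg hp (Real.rpow_nonneg hz.le _))

lemma ex_truncConflictCount_le {z : ℝ} (hD : 0 ≤ D) (hC : 0 ≤ C) (hz : 0 < z) (hz1 : z ≤ 1)
    (hzN : z ≤ 1 - N.p / N.ℓ) (i : Fin m) {v : V} (hv : v ∈ S i) {c : ℕ} (hc : c ∈ N.L v) (K : ℝ) :
    N.ex (N.truncConflictCount (N.innerNbrs (G i) v c) K) ≤ D * (N.p * (1 - z ^ (D * C))) := by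
  refine (N.ex_truncConflictCount_le _ K (1 - z ^ (D * C)) fun u _ c' hc' => ?_).trans ?_
  · refine sub_le_sub_left (rpow_le_pow_of_le hz hz1 hzN ?_) _
    rw [mul_comm]
    exact h.card_nbrs_le hD u c' hc'
  · refine mul_le_mul_of_nonneg_right (h.card_innerNbrs_le i v hv c hc)
      (mul_nonneg N.p_nonneg (sub_nonneg.2 (Real.rpow_le_one hz.le hz1 (mul_nonneg hD hC))))

end IsUnion

/-- The vertex `v` loses too many colors or too many of its neighbors in some `G i` survive. -/
def IsBad {m : ℕ} (G : Fin m → SimpleGraph V) (S : Fin m → Finset V) (M t₁ m₁ m₂ t₂ : ℝ) (v : V)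
    (x : V × Option ℕ → Option ℕ) : Prop :=
  N.keptCount v x ≤ M - t₁ ∨ ∃ i ∈ univ.filter fun i => v ∈ S i, ∃ c ∈ N.L v,
    m₁ + t₂ ≤ N.outerCount (N.innerNbrs (G i) v c) c (N.outerNbrs (G i) c) x ∨
    m₂ + t₂ ≤ N.conflictCount (N.innerNbrs (G i) v c) x

namespace IsUnion

variable {N} {m : ℕ} {G : Fin m → SimpleGraph V} {S : Fin m → Finset V} {C D : ℝ}
  (h : N.IsUnion G S C D)
include h

lemma isBad_congr (M t₁ m₁ m₂ t₂ : ℝ) (v : V) (x y : V × Option ℕ → Option ℕ)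
    (hxy : ∀ i : V × Option ℕ, i.1 ∈ (N.ball v).biUnion N.ball → x i = y i) :
    N.IsBad G S M t₁ m₁ m₂ t₂ v x ↔ N.IsBad G S M t₁ m₁ m₂ t₂ v y := by
  have h1 : N.keptCount v x = N.keptCount v y := N.keptCount_congr fun i hi =>
    hxy i (mem_biUnion.2 ⟨v, N.self_mem_ball v, hi⟩)
  have h2 : ∀ i, ∀ c ∈ N.L v, ∀ j : V × Option ℕ,
      j.1 ∈ (N.innerNbrs (G i) v c).biUnion N.ball → x j = y j := by
    intro i c hc j hj
    refine hxy j (biUnion_subset_biUnion_of_subset_left _ (fun u hu => ?_) hj)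
    obtain ⟨hadj, hcu⟩ := N.mem_innerNbrs.1 hu
    exact N.mem_ball_of_mem_nbrs hc (N.mem_nbrs.2 ⟨h.exists_adj.2 ⟨i, hadj⟩, hcu⟩)
  unfold IsBad
  rw [h1]
  refine or_congr Iff.rfl (exists_congr fun i => and_congr_right fun _ =>
    exists_congr fun c => and_congr_right fun hc => ?_)
  rw [N.conflictCount_congr (h2 i c hc), N.outerCount_congr (fun u hu => (N.mem_innerNbrs.1 hu).2)
    (fun u _ => N.outerNbrs_subset _ _ _) (h2 i c hc)]

lemma ex_isBad_le {z Λ t₁ t₂ K a : ℝ} (hD : 0 ≤ D) (hC : 0 ≤ C) (hΛℓ : Λ ≤ N.ℓ) (hDℓ : D ≤ N.ℓ)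
    (hz : 0 < z) (hz1 : z ≤ 1) (hzN : z ≤ 1 - N.p / N.ℓ)
    (hβ : ∀ u, ∀ c ∈ N.L u, N.β u c * (1 - N.p / N.ℓ) ^ (N.nbrs u c).card = z ^ (D * C))
    (hK : 0 ≤ K) (ha : 0 ≤ a) (ha1 : a ≤ 1) (hab : a * (1 + C) ≤ 1) (haK : a * K ≤ 1) (v : V) :
    N.ex (fun x => propInd (N.IsBad G S (z ^ (D * C) * Λ) t₁
        (D * ((1 - N.p) * z ^ (D * (C - 1)))) (D * (N.p * (1 - z ^ (D * C)))) t₂ v x)) ≤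
      Real.exp (a ^ 2 * (N.ℓ + N.p * (C * D)) - a * t₁) +
      C * (N.ℓ * (Real.exp (a ^ 2 * ((1 + C) ^ 2 * (2 + C) * D) - a * t₂) +
        (Real.exp (a ^ 2 * (K ^ 2 * (1 + C) * D) - a * t₂) + D * N.ℓ * Real.exp (2 - K)))) := by
  set m₁ := D * ((1 - N.p) * z ^ (D * (C - 1)))
  set m₂ := D * (N.p * (1 - z ^ (D * C)))
  set q := Real.exp (a ^ 2 * ((1 + C) ^ 2 * (2 + C) * D) - a * t₂) +
        (Real.exp (a ^ 2 * (K ^ 2 * (1 + C) * D) - a * t₂) + D * N.ℓ * Real.exp (2 - K)) with hq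
  have hq0 : 0 ≤ q := by
    have := mul_nonneg hD N.ℓ_pos'.le
    positivity
  have hpt : ∀ x, propInd (N.IsBad G S (z ^ (D * C) * Λ) t₁ m₁ m₂ t₂ v x) ≤
      propInd (N.keptCount v x ≤ z ^ (D * C) * Λ - t₁) + ∑ i with v ∈ S i, ∑ c ∈ N.L v,
        (propInd (m₁ + t₂ ≤ N.outerCount (N.innerNbrs (G i) v c) c (N.outerNbrs (G i) c) x) +
          propInd (m₂ + t₂ ≤ N.conflictCount (N.innerNbrs (G i) v c) x)) := by
    intro x
    refine (propInd_or_le _ _).trans (add_le_add_right ?_ _)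
    refine (propInd_exists_le _ _).trans (sum_le_sum fun i _ => ?_)
    exact (propInd_exists_le _ _).trans (sum_le_sum fun c _ => propInd_or_le _ _)
  refine (N.ex_mono hpt).trans ?_
  simp only [ex_add, ex_sum]
  refine add_le_add ?_ ?_
  · exact N.keptCount_tail v (C * D) _ t₁ a (h.card_nbrs_le hD v) ha ha1
      (N.le_ex_keptCount hΛℓ (Real.rpow_nonneg hz.le _) hβ v)
  · calc _ ≤ ∑ i with v ∈ S i, ∑ c ∈ N.L v, q := by
          refine sum_le_sum fun i hi => sum_le_sum fun c hc => ?_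
          have hv : v ∈ S i := by simpa using hi
          have hA := h.card_innerNbrs_le i v hv c hc
          refine add_le_add ?_ ?_
          · refine N.outerCount_tail _ c _ C D m₁ t₂ a hC hA (fun u hu => ?_) hDℓ
              (fun w => h.card_common_le i v w c) ha hab (h.ex_outerCount_le hz hz1 hzN hβ i hv hc)
            refine le_trans ?_ (h.card_nbrs_le hD u c (N.mem_innerNbrs.1 hu).2)
            exact_mod_cast card_le_card (N.outerNbrs_subset _ _ _)
          · exact N.conflictCount_tail _ C D K m₂ t₂ a hC hA hDℓ
              (fun u _ c' hc' => h.card_nbrs_le hD u c' hc') hK ha haK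
              (h.ex_truncConflictCount_le hD hC hz hz1 hzN i hv hc K)
      _ ≤ _ := by
          rw [sum_const, sum_const, N.card_L, nsmul_eq_mul, nsmul_eq_mul]
          exact mul_le_mul_of_nonneg_right (h.card_filter_le v) (mul_nonneg N.ℓ_pos'.le hq0)

end IsUnion

end Nibble

lemma eventually_pow_mul_exp_le (A : ℝ) (n : ℕ) :
    ∀ᶠ y : ℝ in Filter.atTop, A * (y ^ n * Real.exp (-y)) ≤ 1 := by
  have h := (Real.tendsto_pow_mul_exp_neg_atTop_nhds_zero n).const_mul A
  rw [mul_zero] at h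
  exact h.eventually (eventually_le_nhds one_pos)

/-- The union bound for the bad events is small enough for the local lemma. -/
lemma eventually_nibble_bound (C : ℝ) (hC : 0 < C) :
    ∀ᶠ y : ℝ in Filter.atTop, ∀ ℓ p t₁ : ℝ, 0 ≤ ℓ → ℓ ≤ (10 * C + 1) * y ^ 10 → 0 ≤ p → p ≤ 1 →
      y ^ 8 ≤ t₁ →
      4 * (Real.exp ((y ^ 5)⁻¹ ^ 2 * (ℓ + p * (C * y ^ 10)) - (y ^ 5)⁻¹ * t₁) +
        C * (ℓ * (Real.exp ((y ^ 5)⁻¹ ^ 2 * ((1 + C) ^ 2 * (2 + C) * y ^ 10) -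
            (y ^ 5)⁻¹ * (y ^ 8 / 2)) +
          (Real.exp ((y ^ 5)⁻¹ ^ 2 * (y ^ 2 * (1 + C) * y ^ 10) - (y ^ 5)⁻¹ * (y ^ 8 / 2)) +
            y ^ 10 * ℓ * Real.exp (2 - y))))) * (1 + ℓ * (C * y ^ 10)) ^ 4 ≤ 1 := by
  set c := 10 * C + 1 with hc
  set V := (1 + C) ^ 2 * (2 + C) + (11 * C + 1) with hV
  filter_upwards [eventually_pow_mul_exp_le
      (4 * ((1 + C * c * (2 + c)) * (1 + c * C) ^ 4) * Real.exp 2) 110,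
    Filter.eventually_ge_atTop 1, Filter.eventually_ge_atTop (2 * V + 2)]
    with y hy hy1 hyV ℓ p t₁ hℓ hℓy hp hp1 ht₁
  have hy0 : 0 < y := by linarith
  have hc0 : 0 < c := by positivity
  have hV1 : (1 + C) ^ 2 * (2 + C) ≤ V := by linarith
  have hV2 : 11 * C + 1 ≤ V := by nlinarith [sq_nonneg (1 + C)]
  have hV3 : 1 + C ≤ V := by linarith
  have hV0 : 0 ≤ V := by linarith
  have hP : 1 ≤ y ^ 10 := one_le_pow₀ hy1
  have key : V * y ^ 2 - y ^ 3 / 2 ≤ 2 - y := by nlinarith [mul_nonneg hy0.le hy0.le]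
  have hVy : V ≤ V * y ^ 2 := le_mul_of_one_le_right hV0 (one_le_pow₀ hy1)
  have e1 : (y ^ 5)⁻¹ ^ 2 * (ℓ + p * (C * y ^ 10)) - (y ^ 5)⁻¹ * t₁ ≤ 2 - y := by
    have h1 : (y ^ 5)⁻¹ * y ^ 8 = y ^ 3 := by field_simp
    have h2 : (y ^ 5)⁻¹ * y ^ 8 ≤ (y ^ 5)⁻¹ * t₁ := mul_le_mul_of_nonneg_left ht₁ (by positivity)
    have h3 : ℓ + p * (C * y ^ 10) ≤ (11 * C + 1) * y ^ 10 := by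
      have : p * (C * y ^ 10) ≤ C * y ^ 10 := mul_le_of_le_one_left (by positivity) hp1
      linarith
    have h4 : (y ^ 5)⁻¹ ^ 2 * (ℓ + p * (C * y ^ 10)) ≤ 11 * C + 1 := by
      refine (mul_le_mul_of_nonneg_left h3 (by positivity)).trans (le_of_eq ?_)
      field_simp
    have h5 : 0 ≤ y ^ 3 := by positivity
    linarith
  have e2 : (y ^ 5)⁻¹ ^ 2 * ((1 + C) ^ 2 * (2 + C) * y ^ 10) - (y ^ 5)⁻¹ * (y ^ 8 / 2) ≤ 2 - y := by
    have h1 : (y ^ 5)⁻¹ ^ 2 * ((1 + C) ^ 2 * (2 + C) * y ^ 10) = (1 + C) ^ 2 * (2 + C) := by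
      field_simp
    have h2 : (y ^ 5)⁻¹ * (y ^ 8 / 2) = y ^ 3 / 2 := by field_simp
    linarith
  have e3 : (y ^ 5)⁻¹ ^ 2 * (y ^ 2 * (1 + C) * y ^ 10) - (y ^ 5)⁻¹ * (y ^ 8 / 2) ≤ 2 - y := by
    have h1 : (y ^ 5)⁻¹ ^ 2 * (y ^ 2 * (1 + C) * y ^ 10) = (1 + C) * y ^ 2 := by field_simp
    have h2 : (y ^ 5)⁻¹ * (y ^ 8 / 2) = y ^ 3 / 2 := by field_simp
    have h3 : (1 + C) * y ^ 2 ≤ V * y ^ 2 := mul_le_mul_of_nonneg_right hV3 (by positivity)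
    linarith
  rw [← Real.exp_le_exp] at e1 e2 e3
  set E := Real.exp (2 - y) with hE
  have hE0 : 0 < E := Real.exp_pos _
  have b1 : 1 + C * (ℓ * (2 + y ^ 10 * ℓ)) ≤ (1 + C * c * (2 + c)) * (y ^ 10) ^ 3 := by
    have h1 : ℓ * (2 + y ^ 10 * ℓ) ≤ c * y ^ 10 * (2 + y ^ 10 * (c * y ^ 10)) := by gcongr
    have h2 : c * y ^ 10 * (2 + y ^ 10 * (c * y ^ 10)) ≤ c * (2 + c) * (y ^ 10) ^ 3 := by
      have : y ^ 10 * 1 ≤ y ^ 10 * (y ^ 10) ^ 2 :=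
        mul_le_mul_of_nonneg_left (one_le_pow₀ hP) (by positivity)
      nlinarith
    have h3 : 1 ≤ (y ^ 10) ^ 3 := one_le_pow₀ hP
    have h4 := mul_le_mul_of_nonneg_left (h1.trans h2) hC.le
    nlinarith
  have b2 : (1 + ℓ * (C * y ^ 10)) ^ 4 ≤ ((1 + c * C) * (y ^ 10) ^ 2) ^ 4 := by
    refine pow_le_pow_left₀ (by positivity) ?_ 4
    have h1 : ℓ * (C * y ^ 10) ≤ c * y ^ 10 * (C * y ^ 10) := by gcongr
    have h3 : 1 ≤ (y ^ 10) ^ 2 := one_le_pow₀ hP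
    nlinarith
  calc _ ≤ 4 * (E + C * (ℓ * (E + (E + y ^ 10 * ℓ * E)))) * (1 + ℓ * (C * y ^ 10)) ^ 4 := by
        gcongr
    _ = 4 * E * ((1 + C * (ℓ * (2 + y ^ 10 * ℓ))) * (1 + ℓ * (C * y ^ 10)) ^ 4) := by ring
    _ ≤ 4 * E * (((1 + C * c * (2 + c)) * (y ^ 10) ^ 3) * ((1 + c * C) * (y ^ 10) ^ 2) ^ 4) := by
        gcongr
    _ = 4 * ((1 + C * c * (2 + c)) * (1 + c * C) ^ 4) * Real.exp 2 * (y ^ 110 * Real.exp (-y)) := by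
        rw [hE, sub_eq_add_neg, Real.exp_add]
        ring
    _ ≤ 1 := hy

lemma exists_nibble_threshold (C : ℝ) (hC : 0 < C) :
    ∃ D₁ : ℕ, ∀ D : ℕ, D₁ ≤ D → ∃ y : ℝ, 2 ≤ y ∧ 1 + C ≤ y ^ 5 ∧ (D : ℝ) = y ^ 10 ∧
      (D : ℝ) ^ ((4 : ℝ) / 5) = y ^ 8 ∧ (D : ℝ) ^ ((1 : ℝ) / 5) = y ^ 2 ∧
      1 ≤ Real.log D ∧ 2 * C ≤ Real.log D ∧
      ∀ ℓ p t₁ : ℝ, 0 ≤ ℓ → ℓ ≤ (10 * C + 1) * y ^ 10 → 0 ≤ p → p ≤ 1 → y ^ 8 ≤ t₁ →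
      4 * (Real.exp ((y ^ 5)⁻¹ ^ 2 * (ℓ + p * (C * y ^ 10)) - (y ^ 5)⁻¹ * t₁) +
        C * (ℓ * (Real.exp ((y ^ 5)⁻¹ ^ 2 * ((1 + C) ^ 2 * (2 + C) * y ^ 10) -
            (y ^ 5)⁻¹ * (y ^ 8 / 2)) +
          (Real.exp ((y ^ 5)⁻¹ ^ 2 * (y ^ 2 * (1 + C) * y ^ 10) - (y ^ 5)⁻¹ * (y ^ 8 / 2)) +
            y ^ 10 * ℓ * Real.exp (2 - y))))) * (1 + ℓ * (C * y ^ 10)) ^ 4 ≤ 1 := by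
  have hy : Filter.Tendsto (fun D : ℕ => (D : ℝ) ^ ((1 : ℝ) / 10)) Filter.atTop Filter.atTop :=
    (tendsto_rpow_atTop (by norm_num)).comp tendsto_natCast_atTop_atTop
  have hlog : Filter.Tendsto (fun D : ℕ => Real.log D) Filter.atTop Filter.atTop :=
    Real.tendsto_log_atTop.comp tendsto_natCast_atTop_atTop
  have hev := (hy.eventually (eventually_nibble_bound C hC)).and
    ((hy.eventually_ge_atTop 2).and (((Filter.tendsto_pow_atTop (n := 5) (by norm_num)).comp
      hy).eventually_ge_atTop (1 + C) |>.and ((hlog.eventually_ge_atTop 1).and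
        (hlog.eventually_ge_atTop (2 * C)))))
  obtain ⟨D₁, hD₁⟩ := Filter.eventually_atTop.1 hev
  refine ⟨D₁, fun D hD => ⟨(D : ℝ) ^ ((1 : ℝ) / 10), ?_⟩⟩
  obtain ⟨h1, h2, h3, h4, h5⟩ := hD₁ D hD
  have hpow : ∀ k : ℕ, ((D : ℝ) ^ ((1 : ℝ) / 10)) ^ k = (D : ℝ) ^ ((k : ℝ) / 10) := by
    intro k
    rw [← Real.rpow_natCast, ← Real.rpow_mul (Nat.cast_nonneg D)]
    congr 1
    ring
  refine ⟨h2, h3, ?_, ?_, ?_, h4, h5, h1⟩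
  · rw [hpow]
    norm_num
  · rw [hpow]
    norm_num
  · rw [hpow]
    norm_num

lemma rpow_four_fifths_le_lamNew {Λ D C p y : ℝ} (hD : 0 < D) (hDΛ : D ≤ Λ) (hp : 0 ≤ p)
    (hpΛ : p ≤ Λ) (hDC : 1 ≤ D * C) (hCp : C * p ≤ 1 / 2) (hy : 2 ≤ y)
    (hDy : D ^ ((1 : ℝ) / 5) = y ^ 2) : Λ ^ ((4 : ℝ) / 5) ≤ lamNew Λ D C p := by
  have hΛ : 0 < Λ := hD.trans_le hDΛ
  have h1 : 1 + D * C * -(p / Λ) ≤ (1 + -(p / Λ)) ^ (D * C) :=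
    one_add_mul_self_le_rpow_one_add (neg_le_neg ((div_le_one hΛ).2 hpΛ)) hDC
  have h2 : D * C * (p / Λ) ≤ 1 / 2 := by
    have h3 : D / Λ ≤ 1 := (div_le_one hΛ).2 hDΛ
    have hCp0 : 0 ≤ C * p := mul_nonneg (by
      by_contra hC
      push Not at hC
      nlinarith) hp
    calc D * C * (p / Λ) = D / Λ * (C * p) := by ring
      _ ≤ C * p := mul_le_of_le_one_left hCp0 h3
      _ ≤ _ := hCp
  have h4 : Λ = Λ ^ ((1 : ℝ) / 5) * Λ ^ ((4 : ℝ) / 5) := by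
    rw [← Real.rpow_add hΛ]
    norm_num
  have h5 : 2 ≤ Λ ^ ((1 : ℝ) / 5) := by
    have := Real.rpow_le_rpow hD.le hDΛ (z := (1 : ℝ) / 5) (by norm_num)
    nlinarith
  have h6 : 0 ≤ Λ ^ ((4 : ℝ) / 5) := Real.rpow_nonneg hΛ.le _
  have h7 : 1 / 2 * Λ ≤ lamNew Λ D C p := by
    refine mul_le_mul_of_nonneg_right ?_ hΛ.le
    rw [sub_eq_add_neg]
    linarith
  nlinarith

/-- A successful random choice exists for every nibble in which the coin flips equalize the
probabilities of keeping a color. -/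
lemma Nibble.IsUnion.exists_forall_not_isBad {V : Type*} [Fintype V] [DecidableEq V] {N : Nibble V}
    {m : ℕ} {G : Fin m → SimpleGraph V} {S : Fin m → Finset V} {C D : ℝ} (h : N.IsUnion G S C D)
    {z Λ t₁ y : ℝ} (hC : 0 ≤ C) (hΛℓ : Λ ≤ N.ℓ) (hDℓ : D ≤ N.ℓ) (hz : 0 < z) (hz1 : z ≤ 1)
    (hzN : z ≤ 1 - N.p / N.ℓ)
    (hβ : ∀ u, ∀ c ∈ N.L u, N.β u c * (1 - N.p / N.ℓ) ^ (N.nbrs u c).card = z ^ (D * C))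
    (hy : 1 ≤ y) (hyC : 1 + C ≤ y ^ 5) (hDy : D = y ^ 10)
    (hbound : 4 * (Real.exp ((y ^ 5)⁻¹ ^ 2 * (N.ℓ + N.p * (C * y ^ 10)) - (y ^ 5)⁻¹ * t₁) +
        C * (N.ℓ * (Real.exp ((y ^ 5)⁻¹ ^ 2 * ((1 + C) ^ 2 * (2 + C) * y ^ 10) -
            (y ^ 5)⁻¹ * (y ^ 8 / 2)) +
          (Real.exp ((y ^ 5)⁻¹ ^ 2 * (y ^ 2 * (1 + C) * y ^ 10) - (y ^ 5)⁻¹ * (y ^ 8 / 2)) +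
            y ^ 10 * N.ℓ * Real.exp (2 - y))))) * (1 + N.ℓ * (C * y ^ 10)) ^ 4 ≤ 1) :
    ∃ x, ∀ v, ¬N.IsBad G S (z ^ (D * C) * Λ) t₁ (D * ((1 - N.p) * z ^ (D * (C - 1))))
      (D * (N.p * (1 - z ^ (D * C)))) (y ^ 8 / 2) v x := by
  have hy0 : 0 < y := by linarith
  have hD : 0 ≤ D := hDy ▸ by positivity
  have hy5 : 0 < y ^ 5 := by positivity
  rw [← hDy] at hbound
  refine N.exists_forall_not _ (h.isBad_congr _ _ _ _ _) (C * D) _ (mul_nonneg hC hD)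
    (h.card_nbrs_le hD) ?_ (h.ex_isBad_le (K := y) (a := (y ^ 5)⁻¹) hD hC hΛℓ hDℓ hz hz1 hzN hβ
      hy0.le (inv_nonneg.2 hy5.le) (inv_le_one_of_one_le₀ (one_le_pow₀ hy)) ?_ ?_) hbound
  · have := N.ℓ_pos'
    positivity
  · rw [inv_mul_le_one₀ hy5]
    exact hyC
  · rw [inv_mul_le_one₀ hy5]
    exact le_self_pow₀ hy (by norm_num)

/-- Every choice of coin flips can be equalized. -/
lemma Nibble.IsUnion.exists_equalizing {V : Type*} [Fintype V] [DecidableEq V] {N : Nibble V}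
    {m : ℕ} {G : Fin m → SimpleGraph V} {S : Fin m → Finset V} {C D : ℝ} (h : N.IsUnion G S C D)
    {z : ℝ} (hD : 0 ≤ D) (hz : 0 < z) (hz1 : z ≤ 1) (hzN : z ≤ 1 - N.p / N.ℓ) :
    ∃ N' : Nibble V, N'.H = N.H ∧ N'.L = N.L ∧ N'.ℓ = N.ℓ ∧ N'.p = N.p ∧ N'.IsUnion G S C D ∧
      ∀ u, ∀ c ∈ N'.L u, N'.β u c * (1 - N'.p / N'.ℓ) ^ (N'.nbrs u c).card = z ^ (D * C) := by
  have hpos : 0 < 1 - N.p / N.ℓ := hz.trans_le hzN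
  refine ⟨{ N with
    β := fun u c => min 1 (z ^ (D * C) / (1 - N.p / N.ℓ) ^ (N.nbrs u c).card)
    β_nonneg := fun u c => le_min zero_le_one
      (div_nonneg (Real.rpow_nonneg hz.le _) (pow_nonneg hpos.le _))
    β_le_one := fun u c => min_le_left _ _ }, rfl, rfl, rfl, rfl,
    ⟨h.H_eq, h.mem_of_adj, h.card_inter_le, h.card_filter_le, h.card_innerNbrs_le⟩, ?_⟩
  intro u c hc
  change min 1 (z ^ (D * C) / (1 - N.p / N.ℓ) ^ (N.nbrs u c).card) *
    (1 - N.p / N.ℓ) ^ (N.nbrs u c).card = z ^ (D * C)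
  have hpow : 0 < (1 - N.p / N.ℓ) ^ (N.nbrs u c).card := pow_pos hpos _
  rw [min_eq_right, div_mul_cancel₀ _ hpow.ne']
  rw [div_le_one hpow]
  refine Nibble.rpow_le_pow_of_le hz hz1 hzN ?_
  rw [mul_comm]
  exact h.card_nbrs_le hD u c hc

/-- **The nibble lemma (list version).**
For `C, ε > 0` and sufficiently large `D`: given nearly disjoint graphs `G₁, …, G_m`
(with vertex sets `S i`), every vertex in at most `C` of them, a list assignment `L` for
`G = ⋃ᵢ Gᵢ` with all color degrees in each `Gᵢ` at most `D`, lists of size exactly `⌈Λ⌉`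
where `(1 + ε)D ≤ Λ ≤ 10CD`, and `(log D)⁻¹ ≥ p ≥ (log D)⁻²`, there exist `X ⊆ V(G)`,
an `L|_X`-coloring `φ` of `G[X]`, and a list assignment `L'` for `G - X` with
`L'(v) ⊆ L(v) \ {φ(u) : u ∈ N_G(v) ∩ X}`, such that
(1) `|L'(v)| = ⌈λ'(Λ,D,C,p) - Λ^{4/5}⌉` for every `v ∈ V(G) \ X`, and
(2) `Δ(Gᵢ - X, L'|) ≤ D'(Λ,D,C,p) + D^{4/5}` for every `i`. -/
theorem nibble_lemma_list (C ε : ℝ) (hC : 0 < C) (hε : 0 < ε) :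
    ∃ D₁ : ℕ, ∀ D : ℕ, D₁ ≤ D →
      ∀ (V : Type) [Fintype V] [DecidableEq V] (m : ℕ) (G : Fin m → SimpleGraph V)
        [∀ i, DecidableRel (G i).Adj] (S : Fin m → Finset V) (L : V → Finset ℕ) (Λ p : ℝ),
        (∀ i u v, (G i).Adj u v → u ∈ S i ∧ v ∈ S i) →
        (∀ i j, i ≠ j → (S i ∩ S j).card ≤ 1) →
        (∀ v ∈ (univ : Finset (Fin m)).biUnion S,
          ((univ.filter fun i => v ∈ S i).card : ℝ) ≤ C) →
        (∀ i, ∀ v ∈ S i, ∀ c ∈ L v,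
          (((G i).neighborFinset v).filter fun u => c ∈ L u).card ≤ D) →
        (∀ v ∈ (univ : Finset (Fin m)).biUnion S, ((L v).card : ℤ) = ⌈Λ⌉) →
        (1 + ε) * D ≤ Λ → Λ ≤ 10 * C * D →
        p ≤ (Real.log D)⁻¹ → ((Real.log D) ^ 2)⁻¹ ≤ p →
        ∃ (X : Finset V) (φ : V → ℕ) (L' : V → Finset ℕ),
          X ⊆ (univ : Finset (Fin m)).biUnion S ∧
          (∀ v ∈ X, φ v ∈ L v) ∧
          (∀ u v, u ∈ X → v ∈ X → (⨆ i, G i).Adj u v → φ u ≠ φ v) ∧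
          (∀ v ∈ (univ : Finset (Fin m)).biUnion S, v ∉ X →
            L' v ⊆ L v ∧ ∀ c ∈ L' v, ∀ u ∈ X, (⨆ i, G i).Adj v u → φ u ≠ c) ∧
          (∀ v ∈ (univ : Finset (Fin m)).biUnion S, v ∉ X →
            ((L' v).card : ℤ) = ⌈lamNew Λ D C p - Λ ^ ((4 : ℝ) / 5)⌉) ∧
          (∀ i, ∀ v ∈ S i, v ∉ X → ∀ c ∈ L' v,
            ((((G i).neighborFinset v).filter fun u => u ∉ X ∧ c ∈ L' u).card : ℝ)
              ≤ degNew Λ D C p + (D : ℝ) ^ ((4 : ℝ) / 5)) := by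
  obtain ⟨D₁, hD₁⟩ := exists_nibble_threshold C hC
  refine ⟨D₁, fun D hD V _ _ m G _ S L Λ p hmem hinter hmult hdeg hcard hΛ hΛ' hp hp' => ?_⟩
  obtain ⟨y, hy2, hyC, hDy, hDy8, hDy2, hlog1, hlogC, hbound⟩ := hD₁ D hD
  have hy1 : 1 ≤ y := by linarith
  have hD1 : (1 : ℝ) ≤ D := hDy ▸ one_le_pow₀ hy1
  have hDΛ : (D : ℝ) ≤ Λ := by nlinarith
  have hΛ0 : 0 < Λ := by linarith
  have hp0 : 0 < p := lt_of_lt_of_le (by positivity) hp'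
  have hp1 : p ≤ 1 := hp.trans (inv_le_one_of_one_le₀ hlog1)
  have hCp : C * p ≤ 1 / 2 := by
    have h1 : p * Real.log D ≤ 1 := by
      have h0 := mul_le_mul_of_nonneg_right hp (by linarith : (0 : ℝ) ≤ Real.log D)
      rwa [inv_mul_cancel₀ (by linarith)] at h0
    nlinarith
  have hDΛ' : (1 : ℝ) < Λ := by
    have : (2 : ℝ) ^ 10 ≤ y ^ 10 := pow_le_pow_left₀ (by norm_num) hy2 10
    norm_num at this
    linarith
  set W := (univ : Finset (Fin m)).biUnion S with hW
  have hSW : ∀ {i v}, v ∈ S i → v ∈ W := fun {i v} hv => mem_biUnion.2 ⟨i, mem_univ i, hv⟩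
  set ℓ := ⌈Λ⌉₊ with hℓ
  have hℓΛ : Λ ≤ ℓ := Nat.le_ceil Λ
  have hℓpos : 0 < ℓ := Nat.ceil_pos.2 hΛ0
  have hℓup : (ℓ : ℝ) ≤ (10 * C + 1) * y ^ 10 := by
    have := (Nat.ceil_lt_add_one hΛ0.le).le
    rw [← hDy]
    linarith
  have hcardℓ : ∀ v ∈ W, (L v).card = ℓ := by
    intro v hv
    have := hcard v hv
    rw [← Int.natCast_ceil_eq_ceil hΛ0.le] at this
    exact_mod_cast this
  let N₀ : Nibble V :=
    { H := ⨆ i, G i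
      L := fun v => if v ∈ W then L v else range ℓ
      ℓ := ℓ
      ℓ_pos := hℓpos
      card_L := fun v => by
        split_ifs with hv
        · exact hcardℓ v hv
        · exact card_range ℓ
      p := p
      p_nonneg := hp0.le
      p_le_one := hp1
      β := fun _ _ => 0
      β_nonneg := fun _ _ => le_rfl
      β_le_one := fun _ _ => zero_le_one }
  have hL₀ : ∀ {v}, v ∈ W → N₀.L v = L v := fun {v} hv => if_pos hv
  have hU₀ : N₀.IsUnion G S C D := by
    refine ⟨rfl, hmem, hinter, fun v => ?_, fun i v hv c hc => ?_⟩
    · by_cases hv : v ∈ W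
      · exact hmult v hv
      · rw [filter_false_of_mem fun i _ hi => hv (hSW hi), card_empty, Nat.cast_zero]
        exact hC.le
    · rw [hL₀ (hSW hv)] at hc
      refine le_trans ?_ (Nat.cast_le.2 (hdeg i v hv c hc))
      refine Nat.cast_le.2 (card_le_card fun u hu => ?_)
      obtain ⟨hadj, hcu⟩ := N₀.mem_innerNbrs.1 hu
      rw [hL₀ (hSW (hmem i _ _ hadj).2)] at hcu
      simpa using ⟨hadj, hcu⟩
  set z := 1 - p / Λ with hz
  have hz0 : 0 < z := sub_pos.2 ((div_lt_one hΛ0).2 (hp1.trans_lt hDΛ'))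
  have hz1 : z ≤ 1 := sub_le_self _ (div_nonneg hp0.le hΛ0.le)
  have hzN : z ≤ 1 - N₀.p / N₀.ℓ := sub_le_sub_left (div_le_div_of_nonneg_left hp0.le hΛ0 hℓΛ) _
  obtain ⟨N, hNH, hNL, hNℓ, hNp, hU, hβ⟩ :=
    hU₀.exists_equalizing (Nat.cast_nonneg D) hz0 hz1 hzN
  have hNℓ' : N.ℓ = ℓ := hNℓ
  have hNp' : N.p = p := hNp
  have hL : ∀ {v}, v ∈ W → N.L v = L v := fun {v} hv => by rw [hNL, hL₀ hv]
  have hH : ∀ {u v}, (⨆ i, G i).Adj u v → N.H.Adj u v := fun {u v} h => by rwa [hNH]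
  have ht₁ : y ^ 8 ≤ Λ ^ ((4 : ℝ) / 5) :=
    hDy8 ▸ Real.rpow_le_rpow (Nat.cast_nonneg D) hDΛ (by norm_num)
  obtain ⟨x, hx⟩ := hU.exists_forall_not_isBad hC.le (hNℓ' ▸ hℓΛ) (hNℓ' ▸ hDΛ.trans hℓΛ) hz0 hz1
    (hNℓ ▸ hNp ▸ hzN) hβ hy1 hyC hDy
    (hbound N.ℓ N.p _ (Nat.cast_nonneg _) (hNℓ' ▸ hℓup) N.p_nonneg N.p_le_one ht₁)
  simp only [Nibble.IsBad, hNp', not_or, not_exists, not_and, not_le, mem_filter, mem_univ,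
    true_and] at hx
  have hkept : ∀ v, ∃ T ⊆ N.kept v x,
      v ∈ W → (T.card : ℤ) = ⌈lamNew Λ D C p - Λ ^ ((4 : ℝ) / 5)⌉ := by
    intro v
    by_cases hv : v ∈ W
    · have hC1 : 1 ≤ C := by
        obtain ⟨i, -, hi⟩ := mem_biUnion.1 hv
        refine le_trans ?_ (hmult v hv)
        exact_mod_cast card_pos.2 ⟨i, by simpa using hi⟩
      have h0 : Λ ^ ((4 : ℝ) / 5) ≤ lamNew Λ D C p := rpow_four_fifths_le_lamNew (by linarith) hDΛ
        hp0.le (hp1.trans hDΛ'.le) (by nlinarith) hCp hy2 hDy2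
      have h1 : ⌈lamNew Λ D C p - Λ ^ ((4 : ℝ) / 5)⌉ ≤ ((N.kept v x).card : ℤ) := by
        rw [Int.ceil_le, Int.cast_natCast, ← N.keptCount_eq_card]
        exact (hx v).1.le
      have h2 : 0 ≤ ⌈lamNew Λ D C p - Λ ^ ((4 : ℝ) / 5)⌉ := Int.ceil_nonneg (sub_nonneg.2 h0)
      obtain ⟨T, hT, hTc⟩ := exists_subset_card_eq (Int.toNat_le.2 h1)
      exact ⟨T, hT, fun _ => by rw [hTc, Int.toNat_of_nonneg h2]⟩
    · exact ⟨∅, empty_subset _, fun h => absurd h hv⟩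
  choose L' hL' hL'card using hkept
  refine ⟨N.colored W x, fun v => (x (v, none)).getD 0, L', N.colored_subset W x, fun v hv => ?_,
    fun u v hu hv hadj => ?_, fun v hv _ => ⟨fun c hc => ?_, fun c hc u hu hadj => ?_⟩,
    fun v hv _ => hL'card v hv, fun i v hv _ c hc => ?_⟩
  · rw [← hL (N.colored_subset W x hv)]
    exact (N.color_spec hv).1
  · exact N.color_ne hu (hH hadj.symm) (N.color_spec hv).2.2
  · rw [← hL hv]
    exact N.kept_subset v x (hL' v hc)
  · exact N.color_ne hu (hH hadj) (N.not_conflict_of_mem_kept (hL' v hc)).2.2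
  · have hcv := (N.not_conflict_of_mem_kept (hL' v hc)).1
    obtain ⟨h1, h2⟩ := (hx v).2 i hv c hcv
    refine (N.card_uncolored_le (W := W) (A := N.innerNbrs (G i) v c)
      (fun u _ => N.outerNbrs_subset (G i) c u) (x := x) fun u hu => ?_).trans ?_
    · simp only [mem_filter, SimpleGraph.mem_neighborFinset] at hu
      have hcu := hL' u hu.2.2
      exact ⟨N.mem_innerNbrs.2 ⟨hu.1, N.kept_subset u x hcu⟩, hSW (hmem i _ _ hu.1).2, hu.2.1, hcu⟩
    · rw [hDy8, degNew]
      linarith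
end

section
/- Let C, Λ, D be positive integers, let G₁, …, G_m be nearly disjoint graphs, and let L be a list assignment for G := ⋃_{i=1}^m G_i. If |{i ∈ [m] : v ∈ V(G_i)}| ≤ C and |L(v)| = Λ for every v ∈ V(G), and Δ(G_i, L|_{V(G_i)}) ≤ D for every i ∈ [m], then there exist nearly disjoint graphs G'₁, …, G'_{m'} for some m' ≥ m and a list assignment L' for G' := ⋃_{i=1}^{m'} G'_i such that: (1) G_i ⊆ G'_i for every i ∈ [m]; (2) L'(v) = L(v) for every v ∈ V(G); (3) |{i ∈ [m'] : v ∈ V(G'_i)}| = C for every v ∈ V(G'); (4) |L'(v)| = Λ for every v ∈ V(G'); and (5) d_{G'_i, L'}(v, c) = D for every i ∈ [m'] and every v ∈ V(G'_i) with c ∈ L'(v). -/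
open Finset

universe u

/-- The number of neighbors of `v` in `G` whose list contains the color `c`. -/
noncomputable def colorDegree {V : Type u} (G : SimpleGraph V) (L : V → Finset ℕ) (v : V)
    (c : ℕ) : ℕ :=
  {u | G.Adj v u ∧ c ∈ L u}.ncard

theorem colorDegree_eq_of_image {V : Type u} {α : Type*} {G : SimpleGraph V} {L : V → Finset ℕ}
    {v : V} {c : ℕ} (g : α → V) (hg : Function.Injective g)
    (h : ∀ u, G.Adj v u ∧ c ∈ L u ↔ ∃ a, g a = u) : colorDegree G L v c = Nat.card α := by
  have : {u | G.Adj v u ∧ c ∈ L u} = Set.range g := Set.ext h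
  rw [colorDegree, this, ← Set.image_univ, Set.ncard_image_of_injective _ hg, Set.ncard_univ]

theorem colorDegree_map {V W : Type u} {G : SimpleGraph V} {M : V → Finset ℕ} {L : W → Finset ℕ}
    (f : V ↪ W) {T : Set V} (hT : ∀ u v, G.Adj u v → u ∈ T ∧ v ∈ T)
    (hL : ∀ w ∈ T, L (f w) = M w) (v : V) (c : ℕ) :
    colorDegree (G.map f) L (f v) c = colorDegree G M v c := by
  have : {u | (G.map f).Adj (f v) u ∧ c ∈ L u} = f '' {u | G.Adj v u ∧ c ∈ M u} := by
    ext u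
    simp only [SimpleGraph.map_adj, Set.mem_ofPred_eq, Set.mem_image]
    constructor
    · rintro ⟨⟨a, b, hab, ha, rfl⟩, hc⟩
      rw [f.injective ha] at hab
      exact ⟨b, ⟨hab, hL b (hT _ _ hab).2 ▸ hc⟩, rfl⟩
    · rintro ⟨b, ⟨hab, hc⟩, rfl⟩
      exact ⟨⟨v, b, hab, rfl, rfl⟩, (hL b (hT _ _ hab).2).symm ▸ hc⟩
  rw [colorDegree, this, Set.ncard_image_of_injective _ f.injective, colorDegree]

section Regularization

variable {V : Type u} (G : SimpleGraph V) (S : Set V) (L : V → Finset ℕ) (N Λ D : ℕ)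

/-- Vertices of the color-regular supergraph: copies `(v, a, b, s)` of the vertices of `G`, and
gadget vertices `((v, c, t), b, s, o)`, which are attached to copies of `v` if `o` holds. -/
abbrev RegVertex (V : Type u) (N D : ℕ) : Type u :=
  (V × Fin D × Fin D × Bool) ⊕ ((V × Fin N × Fin D) × Fin D × Bool × Bool)

/-- The gadget `(v, c, t)` is used if `t` is smaller than the deficit of `c` at `v`. -/
def GadgetActive (q : V × Fin N × Fin D) : Prop :=
  q.1 ∈ S ∧ (q.2.1 : ℕ) ∈ L q.1 ∧ (q.2.2 : ℕ) < D - colorDegree G L q.1 q.2.1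

/-- Adjacency in the color-regular supergraph of `G`. -/
def regAdj : RegVertex V N D → RegVertex V N D → Prop
  | .inl (v, a, b, s), .inl (v', a', b', s') => G.Adj v v' ∧ a = a' ∧ b = b' ∧ s = s'
  | .inl (v, _, b, s), .inr (q, b', s', o) =>
    GadgetActive G S L N D q ∧ q.1 = v ∧ b = b' ∧ s = s' ∧ o = true
  | .inr (q, b', s', o), .inl (v, _, b, s) =>
    GadgetActive G S L N D q ∧ q.1 = v ∧ b = b' ∧ s = s' ∧ o = true
  | .inr (q, _, s, o), .inr (q', _, s', o') => GadgetActive G S L N D q ∧ q = q' ∧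
    ((s = s' ∧ o ≠ o') ∨ (s ≠ s' ∧ o = false ∧ o' = false))

/-- The color-regular supergraph of `G`. -/
def regGraph : SimpleGraph (RegVertex V N D) where
  Adj := regAdj G S L N D
  symm := ⟨by
    rintro (⟨v, a, b, s⟩ | ⟨q, b, s, o⟩) (⟨v', a', b', s'⟩ | ⟨q', b', s', o'⟩) h <;>
      simp only [regAdj] at h ⊢
    · exact ⟨h.1.symm, h.2.1.symm, h.2.2.1.symm, h.2.2.2.symm⟩
    · exact h
    · exact h
    · obtain ⟨h1, rfl, h2⟩ := h
      exact ⟨h1, rfl, by grind⟩⟩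
  loopless := ⟨by
    rintro (⟨v, a, b, s⟩ | ⟨q, b, s, o⟩) h <;> simp [regAdj] at h⟩

/-- The vertices of `regGraph` that are actually used. -/
def regVerts : Set (RegVertex V N D) :=
  {w | Sum.elim (fun x => x.1 ∈ S) (fun x => GadgetActive G S L N D x.1) w}

/-- The `s`-th block of `Λ - 1` colors larger than `N`. -/
def freshColors (N Λ : ℕ) (s : Bool) : Finset ℕ :=
  Ico (N + 1 + s.toNat * Λ) (N + 1 + s.toNat * Λ + (Λ - 1))

/-- The lists on the color-regular supergraph. -/
def regList : RegVertex V N D → Finset ℕ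
  | .inl x => L x.1
  | .inr (q, _, s, o) => insert (if o then (q.2.1 : ℕ) else N) (freshColors N Λ s)

theorem lt_of_mem_freshColors {N Λ : ℕ} {s : Bool} {c : ℕ} (h : c ∈ freshColors N Λ s) :
    N < c := by
  simp only [freshColors, mem_Ico] at h
  omega

theorem eq_of_mem_freshColors {N Λ : ℕ} {s s' : Bool} {c : ℕ} (h : c ∈ freshColors N Λ s)
    (h' : c ∈ freshColors N Λ s') : s = s' := by
  simp only [freshColors, mem_Ico] at h h'
  cases s <;> cases s' <;> simp at h h' ⊢ <;> omega

theorem card_regList (hΛ : 0 < Λ) (hsize : ∀ v ∈ S, (L v).card = Λ) (w : RegVertex V N D)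
    (hw : w ∈ regVerts G S L N D) : (regList L N Λ D w).card = Λ := by
  rcases w with x | ⟨q, b, s, o⟩
  · exact hsize _ hw
  · rw [regList, card_insert_of_notMem]
    · simp only [freshColors, Nat.card_Ico]
      omega
    · intro h
      have hlt := lt_of_mem_freshColors h
      have := q.2.1.isLt
      split at hlt <;> omega

variable {G S L N D}

theorem regVerts_of_adj (hsupp : ∀ u v, G.Adj u v → u ∈ S ∧ v ∈ S) (x y : RegVertex V N D)
    (h : (regGraph G S L N D).Adj x y) : x ∈ regVerts G S L N D ∧ y ∈ regVerts G S L N D := by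
  rcases x with ⟨v, a, b, s⟩ | ⟨q, b, s, o⟩ <;>
    rcases y with ⟨v', a', b', s'⟩ | ⟨q', b', s', o'⟩ <;>
    simp only [regGraph, regAdj, regVerts, Set.mem_ofPred_eq, Sum.elim_inl, Sum.elim_inr] at h ⊢
  · exact hsupp _ _ h.1
  · exact ⟨h.2.1 ▸ h.1.1, h.1⟩
  · exact ⟨h.1, h.2.1 ▸ h.1.1⟩
  · exact ⟨h.1, h.2.1 ▸ h.1⟩

theorem colorDegree_regGraph_inl [Finite V] (hN : ∀ v, ∀ c ∈ L v, c < N)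
    (hdeg : ∀ v ∈ S, ∀ c ∈ L v, colorDegree G L v c ≤ D)
    (v : V) (a b : Fin D) (s : Bool) (hv : v ∈ S) (c : ℕ) (hc : c ∈ L v) :
    colorDegree (regGraph G S L N D) (regList L N Λ D) (.inl (v, a, b, s)) c = D := by
  have hd := hdeg v hv c hc
  rw [colorDegree_eq_of_image (α := {u // G.Adj v u ∧ c ∈ L u} ⊕ Fin (D - colorDegree G L v c))
    (Sum.elim (fun u => .inl (u.1, a, b, s))
      (fun t => .inr ((v, ⟨c, hN v c hc⟩, t.castLE (Nat.sub_le _ _)), b, s, true)))]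
  · rw [Nat.card_sum, Nat.card_fin]
    have : Nat.card {u // G.Adj v u ∧ c ∈ L u} = colorDegree G L v c := rfl
    omega
  · rintro (x | x) (y | y) h <;> simp_all [Subtype.ext_iff, Fin.ext_iff]
  · rintro (⟨v', a', b', s'⟩ | ⟨⟨v', c', t⟩, b', s', o'⟩)
    · simp [regGraph, regAdj, regList]
      grind
    · simp only [regGraph, regAdj, regList, GadgetActive, Sum.exists, Sum.elim_inl, Sum.elim_inr,
        Sum.inr.injEq, reduceCtorEq, exists_false, false_or, Prod.mk.injEq]
      constructor
      · rintro ⟨⟨⟨h1, h2, h3⟩, rfl, rfl, rfl, rfl⟩, h⟩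
        have hcc : c = c' := by
          rcases mem_insert.1 h with h | h
          · simpa using h
          · have := lt_of_mem_freshColors h
            have := hN _ _ hc
            omega
        subst hcc
        exact ⟨⟨t, h3⟩, by simp⟩
      · rintro ⟨t', ⟨rfl, rfl, rfl⟩, rfl, rfl, rfl⟩
        simp [hv, hc]

theorem colorDegree_regGraph_inr (hN : ∀ v, ∀ c ∈ L v, c < N) (q : V × Fin N × Fin D) (b : Fin D)
    (s o : Bool) (hq : GadgetActive G S L N D q) (c : ℕ)
    (hc : c ∈ regList L N Λ D (.inr (q, b, s, o))) :
    colorDegree (regGraph G S L N D) (regList L N Λ D) (.inr (q, b, s, o)) c = D := by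
  have hqN := q.2.1.isLt
  simp only [regList, mem_insert] at hc
  suffices ∃ g : Fin D → RegVertex V N D, Function.Injective g ∧ ∀ u,
      (regGraph G S L N D).Adj (.inr (q, b, s, o)) u ∧ c ∈ regList L N Λ D u ↔ ∃ a, g a = u by
    obtain ⟨g, hg, h⟩ := this
    rw [colorDegree_eq_of_image g hg h, Nat.card_fin]
  rcases hc with rfl | hc
  · cases o
    · refine ⟨fun b' => .inr (q, b', !s, false), fun x y h => by simpa using h, ?_⟩
      rintro (⟨v', a', b', s'⟩ | ⟨q', b', s', o'⟩)
      · simp [regGraph, regAdj]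
      · have := @lt_of_mem_freshColors N Λ s' N
        simp [regGraph, regAdj, regList, hq]
        have := q'.2.1.isLt
        cases s <;> cases s' <;> cases o' <;> simp <;> grind
    · refine ⟨fun a => .inl (q.1, a, b, s), fun x y h => by simpa using h, ?_⟩
      rintro (⟨v', a', b', s'⟩ | ⟨q', b', s', o'⟩)
      · simp only [regGraph, regAdj, regList, hq]
        have := hq.2.1
        simp
        grind
      · have := @lt_of_mem_freshColors N Λ s' q.2.1
        simp [regGraph, regAdj, regList]
        grind
  · have hc' := lt_of_mem_freshColors hc
    refine ⟨fun b' => .inr (q, b', s, !o), fun x y h => by simpa using h, ?_⟩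
    rintro (⟨v', a', b', s'⟩ | ⟨q', b', s', o'⟩)
    · have := hN v' c
      simp [regGraph, regAdj, regList]
      grind
    · have := @eq_of_mem_freshColors N Λ s s' c hc
      simp [regGraph, regAdj, regList, hq]
      grind

end Regularization

/-- A graph with color degrees at most `D` embeds into one with all color degrees equal to `D`. -/
theorem exists_colorRegular_supergraph {V : Type u} [Finite V] {Λ D : ℕ} (hΛ : 0 < Λ) (hD : 0 < D)
    (G : SimpleGraph V) (S : Set V) (L : V → Finset ℕ)
    (hsupp : ∀ u v, G.Adj u v → u ∈ S ∧ v ∈ S) (hsize : ∀ v ∈ S, (L v).card = Λ)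
    (hdeg : ∀ v ∈ S, ∀ c ∈ L v, colorDegree G L v c ≤ D) :
    ∃ (W : Type u) (_ : Finite W) (H : SimpleGraph W) (T : Set W) (M : W → Finset ℕ) (f : V ↪ W),
      (∀ x y, H.Adj x y → x ∈ T ∧ y ∈ T) ∧ (∀ v, f v ∈ T ↔ v ∈ S) ∧
      (∀ u v, G.Adj u v → H.Adj (f u) (f v)) ∧ (∀ v, M (f v) = L v) ∧
      (∀ w ∈ T, (M w).card = Λ) ∧ (∀ w ∈ T, ∀ c ∈ M w, colorDegree H M w c = D) := by
  obtain ⟨N, hN⟩ : ∃ N, ∀ v, ∀ c ∈ L v, c < N := by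
    obtain ⟨N, hN⟩ := (Set.finite_range fun v => (L v).sup id).bddAbove
    refine ⟨N + 1, fun v c hc => Nat.lt_succ_of_le ?_⟩
    exact (le_sup (f := id) hc).trans (hN ⟨v, rfl⟩)
  refine ⟨RegVertex V N D, inferInstance, regGraph G S L N D, regVerts G S L N D, regList L N Λ D,
    ⟨fun v => .inl (v, ⟨0, hD⟩, ⟨0, hD⟩, true), fun x y h => by simpa using h⟩,
    regVerts_of_adj hsupp, fun v => Iff.rfl, fun u v h => ⟨h, rfl, rfl, rfl⟩, fun v => rfl,
    card_regList G S L N Λ D hΛ hsize, ?_⟩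
  rintro (⟨v, a, b, s⟩ | ⟨q, b, s, o⟩) hw c hc
  · exact colorDegree_regGraph_inl Λ hN hdeg v a b s hw c hc
  · exact colorDegree_regGraph_inr Λ hN q b s o hw c hc

/-- Nearly disjoint graphs with color degrees at most `D` embed into nearly disjoint graphs with
all color degrees equal to `D`, the new vertices lying in at most one of the graphs. -/
theorem exists_colorRegular_family {ι V : Type u} [Finite ι] [Finite V] {C Λ D : ℕ} (hC : 0 < C)
    (hΛ : 0 < Λ) (hD : 0 < D) (G : ι → SimpleGraph V) (S : ι → Set V) (L : V → Finset ℕ)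
    (hsupp : ∀ i u v, (G i).Adj u v → u ∈ S i ∧ v ∈ S i)
    (hnd : ∀ i j, i ≠ j → (S i ∩ S j).Subsingleton)
    (hcount : ∀ v, {i | v ∈ S i}.ncard ≤ C)
    (hsize : ∀ i, ∀ v ∈ S i, (L v).card = Λ)
    (hdeg : ∀ i, ∀ v ∈ S i, ∀ c ∈ L v, colorDegree (G i) L v c ≤ D) :
    ∃ (W : Type u) (_ : Finite W) (H : ι → SimpleGraph W) (T : ι → Set W) (M : W → Finset ℕ)
      (f : V ↪ W),
      (∀ i u v, (H i).Adj u v → u ∈ T i ∧ v ∈ T i) ∧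
      (∀ i j, i ≠ j → (T i ∩ T j).Subsingleton) ∧
      (∀ i, ∀ v ∈ S i, f v ∈ T i) ∧
      (∀ i u v, (G i).Adj u v → (H i).Adj (f u) (f v)) ∧
      (∀ v, M (f v) = L v) ∧
      (∀ w, {i | w ∈ T i}.ncard ≤ C) ∧
      (∀ i, ∀ w ∈ T i, (M w).card = Λ) ∧
      (∀ i, ∀ w ∈ T i, ∀ c ∈ M w, colorDegree (H i) M w c = D) := by
  classical
  choose W hW H T M f hTadj hfT hGH hML hMcard hHdeg using fun i =>
    exists_colorRegular_supergraph hΛ hD (G i) (S i) L (hsupp i) (hsize i) (hdeg i)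
  -- glue all the supergraphs along the copies of `V`
  have hψ (i : ι) : ∃ ψ : W i ↪ V ⊕ (Σ i, W i), (∀ v, ψ (f i v) = .inl v) ∧
      (∀ w v, ψ w = .inl v → w = f i v) ∧ ∀ w x, ψ w = .inr x → x = ⟨i, w⟩ := by
    let ψ : W i → V ⊕ (Σ i, W i) := fun w =>
      if h : ∃ v, f i v = w then .inl h.choose else .inr ⟨i, w⟩
    have h1 (v) : ψ (f i v) = .inl v := by
      have h : ∃ v', f i v' = f i v := ⟨v, rfl⟩
      simp only [ψ, dif_pos h, (f i).injective h.choose_spec]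
    have h2 (w v) (hw : ψ w = .inl v) : w = f i v := by
      by_cases h : ∃ v, f i v = w
      · obtain ⟨v', rfl⟩ := h
        rw [h1] at hw
        rw [Sum.inl.inj hw]
      · simp [ψ, dif_neg h] at hw
    have h3 (w x) (hw : ψ w = .inr x) : x = ⟨i, w⟩ := by
      by_cases h : ∃ v, f i v = w
      · simp [ψ, dif_pos h] at hw
      · exact (Sum.inr.inj ((dif_neg h).symm.trans hw)).symm
    refine ⟨⟨ψ, fun w w' h => ?_⟩, h1, h2, h3⟩
    rcases hx : ψ w with v | x
    · rw [h2 w v hx, h2 w' v (h ▸ hx)]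
    · simpa using (h3 w x hx).symm.trans (h3 w' x (h ▸ hx))
  choose ψ hψf hψl hψr using hψ
  let M' : V ⊕ (Σ i, W i) → Finset ℕ := Sum.elim L fun x => M x.1 x.2
  have hM' (i) (w : W i) : M' (ψ i w) = M i w := by
    rcases h : ψ i w with v | x
    · rw [hψl i w v h, hML]; rfl
    · rw [hψr i w x h]; rfl
  have hinl (i v) (h : Sum.inl v ∈ ψ i '' T i) : v ∈ S i := by
    obtain ⟨w, hw, h⟩ := h
    rwa [hψl i w v h, hfT] at hw
  have hinr (i x) (h : Sum.inr x ∈ ψ i '' T i) : i = x.1 := by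
    obtain ⟨w, hw, h⟩ := h
    rw [hψr i w x h]
  refine ⟨V ⊕ (Σ i, W i), inferInstance, fun i => (H i).map (ψ i), fun i => ψ i '' T i, M',
    ⟨Sum.inl, Sum.inl_injective⟩, ?_, ?_, ?_, ?_, fun v => rfl, ?_, ?_, ?_⟩
  · intro i _ _ h
    obtain ⟨x, y, hxy, rfl, rfl⟩ := (SimpleGraph.map_adj ..).1 h
    exact ⟨⟨x, (hTadj i _ _ hxy).1, rfl⟩, ⟨y, (hTadj i _ _ hxy).2, rfl⟩⟩
  · rintro i j hij (v | x) ⟨hx, hx'⟩ (v' | y) ⟨hy, hy'⟩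
    · rw [hnd i j hij ⟨hinl i v hx, hinl j v hx'⟩ ⟨hinl i v' hy, hinl j v' hy'⟩]
    · exact absurd ((hinr i y hy).trans (hinr j y hy').symm) hij
    · exact absurd ((hinr i x hx).trans (hinr j x hx').symm) hij
    · exact absurd ((hinr i x hx).trans (hinr j x hx').symm) hij
  · exact fun i v hv => ⟨f i v, (hfT i v).2 hv, hψf i v⟩
  · exact fun i u v h => (SimpleGraph.map_adj ..).2 ⟨f i u, f i v, hGH i u v h, hψf i u, hψf i v⟩
  · rintro (v | x)
    · exact (Set.ncard_le_ncard fun i h => hinl i v h).trans (hcount v)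
    · refine (Set.ncard_le_ncard (t := {x.1}) fun i h => hinr i x h).trans ?_
      rwa [Set.ncard_singleton]
  · rintro i _ ⟨w, hw, rfl⟩
    rw [hM', hMcard i w hw]
  · rintro i _ ⟨w, hw, rfl⟩ c hc
    rw [colorDegree_map (ψ i) (hTadj i) (fun w _ => hM' i w)]
    exact hHdeg i w hw c (hM' i w ▸ hc)

section Lines

variable {V : Type u} {C D : ℕ}

/-- The combinatorial line in direction `t` through the copies of `v`. Lines are
labelled by their unique point whose `t`-th coordinate is `p₀`. -/
def lineVerts (p₀ : Fin D × Bool) (v : V) (t : Fin C) (k : Fin C → Fin D × Bool) :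
    Set (V × (Fin C → Fin D × Bool)) :=
  {w | w.1 = v ∧ Function.update w.2 t p₀ = k}

/-- The complete bipartite graph on a combinatorial line. -/
def lineGraph (p₀ : Fin D × Bool) (v : V) (t : Fin C) (k : Fin C → Fin D × Bool) :
    SimpleGraph (V × (Fin C → Fin D × Bool)) where
  Adj x y := x ∈ lineVerts p₀ v t k ∧ y ∈ lineVerts p₀ v t k ∧ (x.2 t).2 ≠ (y.2 t).2
  symm := ⟨fun _ _ h => ⟨h.2.1, h.1, h.2.2.symm⟩⟩
  loopless := ⟨fun _ h => h.2.2 rfl⟩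

theorem colorDegree_lineGraph {p₀ : Fin D × Bool} {v : V} {t : Fin C}
    {k : Fin C → Fin D × Bool} {x : V × (Fin C → Fin D × Bool)} (hx : x ∈ lineVerts p₀ v t k)
    (M : V → Finset ℕ) (c : ℕ) (hc : c ∈ M x.1) :
    colorDegree (lineGraph p₀ v t k) (fun w => M w.1) x c = D := by
  obtain ⟨x, k'⟩ := x
  obtain ⟨rfl, rfl⟩ := hx
  rw [colorDegree_eq_of_image
    (fun a : Fin D => (x, Function.update k' t (a, !(k' t).2))), Nat.card_fin]
  · intro a b h
    simpa using congrFun (Prod.ext_iff.1 h).2 t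
  · rintro ⟨y, l⟩
    simp only [lineGraph, lineVerts, Set.mem_ofPred_eq, Prod.mk.injEq]
    constructor
    · rintro ⟨⟨-, ⟨rfl, h⟩, hne⟩, -⟩
      refine ⟨(l t).1, rfl, funext fun r => ?_⟩
      by_cases hr : r = t
      · subst hr
        rw [Function.update_self]
        exact Prod.ext rfl (Bool.eq_not.2 hne.symm).symm
      · simpa [hr] using (congrFun h r).symm
    · rintro ⟨a, rfl, rfl⟩
      simp [hc]

theorem lineVerts_inter_subsingleton {p₀ : Fin D × Bool} {v v' : V} {t t' : Fin C}
    {k k' : Fin C → Fin D × Bool} (h : (v, t, k) ≠ (v', t', k')) :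
    (lineVerts p₀ v t k ∩ lineVerts p₀ v' t' k').Subsingleton := by
  rintro ⟨x, l⟩ ⟨⟨rfl, rfl⟩, rfl, rfl⟩ ⟨y, l'⟩ ⟨⟨rfl, h1⟩, -, h2⟩
  have ht : t ≠ t' := by
    rintro rfl
    exact h rfl
  refine Prod.ext rfl (funext fun r => ?_)
  by_cases hr : r = t
  · simpa [show r ≠ t' by rwa [hr]] using (congrFun h2 r).symm
  · simpa [hr] using (congrFun h1 r).symm

end Lines

/-- Nearly disjoint color-regular graphs, each vertex being in at most `C` of them, embed into
nearly disjoint color-regular graphs with each vertex in exactly `C` of them. -/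
theorem exists_regular_multiplicity {ι V : Type u} [Finite ι] [Finite V] {C Λ D : ℕ} (hD : 0 < D)
    (G : ι → SimpleGraph V) (S : ι → Set V) (L : V → Finset ℕ)
    (hsupp : ∀ i u v, (G i).Adj u v → u ∈ S i ∧ v ∈ S i)
    (hnd : ∀ i j, i ≠ j → (S i ∩ S j).Subsingleton)
    (hcount : ∀ v, {i | v ∈ S i}.ncard ≤ C)
    (hsize : ∀ i, ∀ v ∈ S i, (L v).card = Λ)
    (hdeg : ∀ i, ∀ v ∈ S i, ∀ c ∈ L v, colorDegree (G i) L v c = D) :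
    ∃ (κ W : Type u) (_ : Finite κ) (_ : Finite W) (e : ι ↪ κ) (H : κ → SimpleGraph W)
      (T : κ → Set W) (M : W → Finset ℕ) (f : V ↪ W),
      (∀ i u v, (H i).Adj u v → u ∈ T i ∧ v ∈ T i) ∧
      (∀ i j, i ≠ j → (T i ∩ T j).Subsingleton) ∧
      (∀ i, ∀ v ∈ S i, f v ∈ T (e i)) ∧
      (∀ i u v, (G i).Adj u v → (H (e i)).Adj (f u) (f v)) ∧
      (∀ v, M (f v) = L v) ∧
      (∀ i, ∀ w ∈ T i, {i | w ∈ T i}.ncard = C) ∧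
      (∀ i, ∀ w ∈ T i, (M w).card = Λ) ∧
      (∀ i, ∀ w ∈ T i, ∀ c ∈ M w, colorDegree (H i) M w c = D) := by
  classical
  let p₀ : Fin D × Bool := (⟨0, hD⟩, true)
  let K := Fin C → Fin D × Bool
  let r (v : V) : ℕ := {i | v ∈ S i}.ncard
  -- the lines through copies of `v` that are needed
  let A (v : V) (t : Fin C) : Prop := (∃ i, v ∈ S i) ∧ (t : ℕ) < C - r v
  let ψ (k : K) : V ↪ V × K := ⟨fun v => (v, k), fun x y h => (Prod.ext_iff.1 h).1⟩
  let T : (ι × K) ⊕ (V × Fin C × K) → Set (V × K) := Sum.elim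
    (fun x => ψ x.2 '' S x.1)
    (fun x => if A x.1 x.2.1 then lineVerts p₀ x.1 x.2.1 x.2.2 else ∅)
  let H : (ι × K) ⊕ (V × Fin C × K) → SimpleGraph (V × K) := Sum.elim
    (fun x => (G x.1).map (ψ x.2))
    (fun x => if A x.1 x.2.1 then lineGraph p₀ x.1 x.2.1 x.2.2 else ⊥)
  have hTl (i k w) : w ∈ T (.inl (i, k)) ↔ w.1 ∈ S i ∧ w.2 = k := by
    constructor
    · rintro ⟨v, hv, rfl⟩
      exact ⟨hv, rfl⟩
    · rintro ⟨hw, rfl⟩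
      exact ⟨w.1, hw, rfl⟩
  have hTr (v t k w) : w ∈ T (.inr (v, t, k)) ↔ A v t ∧ w ∈ lineVerts p₀ v t k := by
    by_cases h : A v t <;> simp [T, h]
  have hHr (v t k) (h : A v t) : H (.inr (v, t, k)) = lineGraph p₀ v t k := if_pos h
  have hmixed (i k v t k') :
      (T (.inl (i, k)) ∩ T (.inr (v, t, k'))).Subsingleton := by
    rintro ⟨x, l⟩ ⟨h1, h2⟩ ⟨y, l'⟩ ⟨h3, h4⟩
    rw [hTl] at h1 h3
    rw [hTr] at h2 h4
    exact Prod.ext (h2.2.1.trans h4.2.1.symm) (h1.2.trans h3.2.symm)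
  have hmem (j w) (hw : w ∈ T j) : ∃ i, w.1 ∈ S i := by
    rcases j with ⟨i, k⟩ | ⟨v, t, k⟩
    · exact ⟨i, ((hTl ..).1 hw).1⟩
    · obtain ⟨h, rfl, -⟩ := (hTr ..).1 hw
      exact h.1
  let e : ι ↪ (ι × K) ⊕ (V × Fin C × K) :=
    ⟨fun i => .inl (i, fun _ => p₀), fun i j h => (Prod.ext_iff.1 (Sum.inl.inj h)).1⟩
  refine ⟨_, V × K, inferInstance, inferInstance, e, H, T, fun w => L w.1, ψ fun _ => p₀, ?_, ?_,
    fun i v hv => (hTl i _ (v, _)).2 ⟨hv, rfl⟩,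
    fun i u v h => (SimpleGraph.map_adj (ψ fun _ => p₀) (G i) _ _).2 ⟨u, v, h, rfl, rfl⟩,
    fun v => rfl, ?_, ?_, ?_⟩
  · rintro (⟨i, k⟩ | ⟨v, t, k⟩) x y h
    · obtain ⟨x, y, hxy, rfl, rfl⟩ := (SimpleGraph.map_adj ..).1 h
      exact ⟨⟨x, (hsupp i _ _ hxy).1, rfl⟩, ⟨y, (hsupp i _ _ hxy).2, rfl⟩⟩
    · by_cases hA : A v t
      · rw [hHr v t k hA] at h
        exact ⟨(hTr ..).2 ⟨hA, h.1⟩, (hTr ..).2 ⟨hA, h.2.1⟩⟩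
      · simp [H, hA] at h
  · rintro (⟨i, k⟩ | ⟨v, t, k⟩) (⟨i', k'⟩ | ⟨v', t', k'⟩) hne
    · rintro ⟨x, l⟩ ⟨h1, h2⟩ ⟨y, l'⟩ ⟨h3, h4⟩
      rw [hTl] at h1 h2 h3 h4
      have hk : k = k' := h1.2.symm.trans h2.2
      have hi : i ≠ i' := by
        rintro rfl
        exact hne (by rw [hk])
      exact Prod.ext (hnd i i' hi ⟨h1.1, h2.1⟩ ⟨h3.1, h4.1⟩) (h1.2.trans h3.2.symm)
    · exact hmixed ..
    · rw [Set.inter_comm]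
      exact hmixed ..
    · refine (lineVerts_inter_subsingleton (p₀ := p₀) fun h => hne (congrArg _ h)).anti ?_
      exact fun w hw => ⟨((hTr ..).1 hw.1).2, ((hTr ..).1 hw.2).2⟩
  · rintro j ⟨v, l⟩ hw
    have hv := hmem j _ hw
    have hset : {j | (v, l) ∈ T j} = (fun i => .inl (i, l)) '' {i | v ∈ S i} ∪
        (fun t : Fin (C - r v) => .inr (v, t.castLE (Nat.sub_le _ _),
          Function.update l (t.castLE (Nat.sub_le _ _)) p₀)) '' Set.univ := by
      ext (⟨i, k⟩ | ⟨v', t, k⟩)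
      · simp [hTl]
      · simp only [Set.mem_ofPred_eq, hTr, lineVerts, A, Set.mem_union, Set.mem_image, reduceCtorEq,
          and_false, exists_false, false_or, Set.mem_univ, true_and, Sum.inr.injEq, Prod.mk.injEq]
        constructor
        · rintro ⟨⟨-, ht⟩, rfl, rfl⟩
          exact ⟨⟨t, ht⟩, rfl, rfl, rfl⟩
        · rintro ⟨t, rfl, rfl, rfl⟩
          exact ⟨⟨hv, t.isLt⟩, rfl, rfl⟩
    have hr : r v ≤ C := hcount v
    rw [hset, Set.ncard_union_eq, Set.ncard_image_of_injective, Set.ncard_image_of_injective,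
      Set.ncard_univ, Nat.card_fin]
    · exact Nat.add_sub_of_le hr
    · intro a b h
      simpa [Fin.ext_iff] using (Prod.ext_iff.1 (Prod.ext_iff.1 (Sum.inr.inj h)).2).1
    · intro a b h
      simpa using h
    · rw [Set.disjoint_left]
      rintro _ ⟨i, -, rfl⟩ ⟨t, -, h⟩
      simp at h
  · intro j w hw
    obtain ⟨i, hi⟩ := hmem j w hw
    exact hsize i _ hi
  · rintro (⟨i, k⟩ | ⟨v, t, k⟩) w hw c hc
    · obtain ⟨v, hv, rfl⟩ := hw
      exact (colorDegree_map (ψ k) (hsupp i) (fun w _ => rfl) v c).trans (hdeg i v hv c hc)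
    · rw [hTr] at hw
      rw [hHr v t k hw.1]
      exact colorDegree_lineGraph hw.2 L c hc

theorem exists_equiv_extending_embedding {m : ℕ} {κ : Type*} [Finite κ] (e : Fin m ↪ κ) :
    ∃ (m' : ℕ) (hm : m ≤ m') (φ : Fin m' ≃ κ), ∀ i, φ (Fin.castLE hm i) = e i := by
  classical
  have : Fintype κ := Fintype.ofFinite κ
  let g : Fin m ⊕ {j // j ∉ Set.range e} ≃ κ :=
    ((Equiv.ofInjective e e.injective).sumCongr (Equiv.refl _)).trans
      (Equiv.sumCompl (· ∈ Set.range e))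
  refine ⟨m + Fintype.card {j // j ∉ Set.range e}, Nat.le_add_right _ _,
    finSumFinEquiv.symm.trans
      (((Equiv.refl _).sumCongr (Fintype.equivFin _).symm).trans g), fun i => ?_⟩
  have : Fin.castLE (Nat.le_add_right m (Fintype.card {j // j ∉ Set.range e})) i =
      finSumFinEquiv (.inl i) := rfl
  rw [this]
  simp [g]

/-- **The embedding proposition.**
Given nearly disjoint graphs `G₁, …, G_m` (with vertex sets `S i`), each vertex in at
most `C` of them, all lists of size exactly `Λ` and all color degrees in each `Gᵢ` at
most `D`, there exist nearly disjoint graphs `G'₁, …, G'_{m'}` (with vertex sets `S' i`,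
`m' ≥ m`) on a larger vertex set and a list assignment `L'` for their union such that
(1) `Gᵢ ⊆ G'ᵢ` for `i ∈ [m]` (via an injection `f` of vertex sets);
(2) `L'` agrees with `L` on `V(G)`;
(3) every vertex of `V(G')` lies in exactly `C` of the `G'ᵢ`;
(4) `|L'(v)| = Λ` for every `v ∈ V(G')`; and
(5) `d_{G'ᵢ, L'}(v, c) = D` for every `i ∈ [m']`, `v ∈ V(G'ᵢ)` and `c ∈ L'(v)`. -/
theorem embedding_proposition (C Λ D : ℕ) (hC : 0 < C) (hΛ : 0 < Λ) (hD : 0 < D)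
    (V : Type) [Fintype V] [DecidableEq V] (m : ℕ) (G : Fin m → SimpleGraph V)
    [∀ i, DecidableRel (G i).Adj] (S : Fin m → Finset V) (L : V → Finset ℕ)
    (hsupp : ∀ i u v, (G i).Adj u v → u ∈ S i ∧ v ∈ S i)
    (hnd : ∀ i j, i ≠ j → (S i ∩ S j).card ≤ 1)
    (hcount : ∀ v ∈ (univ : Finset (Fin m)).biUnion S,
      (univ.filter fun i => v ∈ S i).card ≤ C)
    (hsize : ∀ v ∈ (univ : Finset (Fin m)).biUnion S, (L v).card = Λ)
    (hdeg : ∀ i, ∀ v ∈ S i, ∀ c ∈ L v,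
      (((G i).neighborFinset v).filter fun u => c ∈ L u).card ≤ D) :
    ∃ (V' : Type) (_ : Fintype V') (_ : DecidableEq V') (m' : ℕ) (hm : m ≤ m')
      (G' : Fin m' → SimpleGraph V') (S' : Fin m' → Finset V') (L' : V' → Finset ℕ)
      (f : V ↪ V'),
      -- the `G'ᵢ` have vertex sets `S' i` and are nearly disjoint
      (∀ i u v, (G' i).Adj u v → u ∈ S' i ∧ v ∈ S' i) ∧
      (∀ i j, i ≠ j → (S' i ∩ S' j).card ≤ 1) ∧
      -- (1) `Gᵢ ⊆ G'ᵢ`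
      (∀ i : Fin m, ∀ v ∈ S i, f v ∈ S' (Fin.castLE hm i)) ∧
      (∀ i : Fin m, ∀ u v, (G i).Adj u v → (G' (Fin.castLE hm i)).Adj (f u) (f v)) ∧
      -- (2) lists are preserved on `V(G)`
      (∀ v ∈ (univ : Finset (Fin m)).biUnion S, L' (f v) = L v) ∧
      -- (3) each vertex of `V(G')` is in exactly `C` of the graphs
      (∀ v' ∈ (univ : Finset (Fin m')).biUnion S',
        (univ.filter fun i => v' ∈ S' i).card = C) ∧
      -- (4) all lists have size `Λ`
      (∀ v' ∈ (univ : Finset (Fin m')).biUnion S', (L' v').card = Λ) ∧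
      -- (5) all color degrees are exactly `D`
      (∀ i, ∀ v' ∈ S' i, ∀ c ∈ L' v',
        {u | (G' i).Adj v' u ∧ c ∈ L' u}.ncard = D) := by
  classical
  have hmem {i v} (hv : v ∈ S i) : v ∈ (univ : Finset (Fin m)).biUnion S :=
    mem_biUnion.2 ⟨i, mem_univ i, hv⟩
  obtain ⟨W, _, H, T, M, f, h1, h2, h3, h4, h5, h6, h7, h8⟩ :=
    exists_colorRegular_family hC hΛ hD G (fun i => (S i : Set V)) L hsupp
      (fun i j hij => by
        rw [← coe_inter]
        exact Finset.card_le_one_iff_subsingleton.1 (hnd i j hij))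
      (fun v => by
        have : {i | v ∈ (S i : Set V)} = ↑(univ.filter fun i => v ∈ S i) := by
          ext; simp
        rw [this, Set.ncard_coe_finset]
        by_cases hv : v ∈ (univ : Finset (Fin m)).biUnion S
        · exact hcount v hv
        · rw [filter_eq_empty_iff.2 fun i _ hi => hv (hmem hi)]
          simp)
      (fun i v hv => hsize v (hmem hv))
      (fun i v hv c hc => by
        have : {u | (G i).Adj v u ∧ c ∈ L u} =
            ↑(((G i).neighborFinset v).filter fun u => c ∈ L u) := by
          ext; simp
        rw [colorDegree, this, Set.ncard_coe_finset]
        exact hdeg i v hv c hc)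
  obtain ⟨κ, X, _, _, e, H', T', M', f', k1, k2, k3, k4, k5, k6, k7, k8⟩ :=
    exists_regular_multiplicity hD H T M h1 h2 h6 h7 h8
  obtain ⟨m', hm, φ, hφ⟩ := exists_equiv_extending_embedding e
  have : Fintype X := Fintype.ofFinite X
  refine ⟨X, inferInstance, inferInstance, m', hm, fun i => H' (φ i), fun i => (T' (φ i)).toFinset,
    M', f.trans f', ?_, ?_, ?_, ?_, ?_, ?_, ?_, ?_⟩
  · simpa using fun i => k1 (φ i)
  · intro i j hij
    rw [Finset.card_le_one_iff_subsingleton]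
    simpa using k2 (φ i) (φ j) (φ.injective.ne hij)
  · intro i v hv
    simpa [hφ] using k3 i _ (h3 i v hv)
  · intro i u v h
    simpa [hφ] using k4 i _ _ (h4 i u v h)
  · intro v _
    exact (k5 _).trans (h5 v)
  · intro x hx
    obtain ⟨i, -, hi⟩ := mem_biUnion.1 hx
    rw [← k6 (φ i) x (Set.mem_toFinset.1 hi), ← Set.ncard_coe_finset,
      ← Set.ncard_image_of_injective _ φ.injective]
    congr 1
    ext j
    simp
  · intro x hx
    obtain ⟨i, -, hi⟩ := mem_biUnion.1 hx
    exact k7 (φ i) x (Set.mem_toFinset.1 hi)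
  · intro i x hx c hc
    exact k8 (φ i) x (Set.mem_toFinset.1 hx) c hc
end
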